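/- arXiv:2408.14665 — 9 statements merged into one kernel-verified Lean document; each statement's English description precedes it below -/
import Mathlib

section
/- Let k be a field, n a positive integer, t = (t_1,...,t_n) an n-tuple of positive integers, and let j, j' be n-tuples of nonnegative integers with j ≠ j'. Then the additive subgroups ℛ_t·𝒴_t^j and ℛ_t·𝒴_t^{j'} of k[X_1,...,X_n] intersect trivially: ℛ_t·𝒴_t^j ∩ ℛ_t·𝒴_t^{j'} = {0}. -/
open MvPolynomial

theorem MvPolynomial.degreeOf_X_pow_sub_one {k σ : Type*} [Field k] [DecidableEq σ] (i l : σ)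
    {m : ℕ} (hm : 0 < m) :
    degreeOf i (X l ^ m - 1 : MvPolynomial σ k) = if l = i then m else 0 := by
  split_ifs with h
  · subst h
    rw [sub_eq_add_neg, degreeOf_add_eq_of_degreeOf_lt] <;> simp [degreeOf_neg, hm]
  · refine Nat.le_zero.mp ((degreeOf_sub_le _ _ _).trans ?_)
    simp [degreeOf_X_pow_of_ne m (Ne.symm h)]

theorem MvPolynomial.X_pow_sub_one_ne_zero {k σ : Type*} [Field k] (l : σ) {m : ℕ} (hm : 0 < m) :
    (X l ^ m - 1 : MvPolynomial σ k) ≠ 0 := by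
  classical
  intro h
  have := degreeOf_X_pow_sub_one (k := k) l l hm
  simp [h] at this
  omega

theorem MvPolynomial.degreeOf_mul_prod_X_pow_sub_one_pow {k σ : Type*} [Field k] [Fintype σ]
    {t : σ → ℕ} (ht : ∀ i, 0 < t i) (j : σ → ℕ) {g : MvPolynomial σ k} (hg : g ≠ 0) (i : σ) :
    degreeOf i (g * ∏ l, (X l ^ t l - 1) ^ j l) = degreeOf i g + t i * j i := by
  classical
  have hne (l : σ) : (X l ^ t l - 1 : MvPolynomial σ k) ^ j l ≠ 0 :=
    pow_ne_zero _ (X_pow_sub_one_ne_zero l (ht l))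
  rw [degreeOf_mul_eq hg (Finset.prod_ne_zero_iff.mpr fun l _ => hne l),
    degreeOf_prod_eq _ _ fun l _ => hne l]
  simp [degreeOf_pow_eq _ _ _ (X_pow_sub_one_ne_zero _ (ht _)), degreeOf_X_pow_sub_one _ _ (ht _),
    mul_comm]

theorem stmt_1 {k : Type*} [Field k] {n : ℕ} (hn : 0 < n)
    (t : Fin n → ℕ) (ht : ∀ i, 0 < t i)
    (j j' : Fin n → ℕ) (hjj : j ≠ j')
    (f : MvPolynomial (Fin n) k)
    (h1 : ∃ g : MvPolynomial (Fin n) k, (∀ i, g.degreeOf i < t i) ∧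
      f = g * ∏ i, (X i ^ t i - 1) ^ j i)
    (h2 : ∃ g : MvPolynomial (Fin n) k, (∀ i, g.degreeOf i < t i) ∧
      f = g * ∏ i, (X i ^ t i - 1) ^ j' i) :
    f = 0 := by
  obtain ⟨g, hg, hf⟩ := h1
  obtain ⟨g', hg', hf'⟩ := h2
  by_contra hne
  have hg0 : g ≠ 0 := by rintro rfl; simp [hf] at hne
  have hg0' : g' ≠ 0 := by rintro rfl; simp [hf'] at hne
  refine hjj (funext fun i => ?_)
  have hdiv : degreeOf i f / t i = j i := by
    rw [hf, degreeOf_mul_prod_X_pow_sub_one_pow ht j hg0, Nat.add_mul_div_left _ _ (ht i),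
      Nat.div_eq_of_lt (hg i), zero_add]
  have hdiv' : degreeOf i f / t i = j' i := by
    rw [hf', degreeOf_mul_prod_X_pow_sub_one_pow ht j' hg0', Nat.add_mul_div_left _ _ (ht i),
      Nat.div_eq_of_lt (hg' i), zero_add]
  exact hdiv.symm.trans hdiv'
end

section
/- Let k be a field, n a positive integer, and let t = (t_1,...,t_n) and j = (j_1,...,j_n) be n-tuples of positive integers. Let t∘j denote the entrywise product (t_1·j_1,...,t_n·j_n). Then ℛ_{t∘j} is the internal direct sum of additive subgroups ℛ_{t∘j} = ⊕_y ℛ_t·𝒴_t^y, where y ranges over all n-tuples of nonnegative integers with y_i < j_i for every 1 ≤ i ≤ n. -/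
open MvPolynomial

/-- The submodule `ℛ_t` of polynomials of degree less than `t l` in each variable `X l`. -/
noncomputable def degreeOfLT {σ : Type*} (k : Type*) [CommSemiring k] (t : σ → ℕ) :
    Submodule k (MvPolynomial σ k) :=
  restrictSupport k {m | ∀ l, m l < t l}

theorem mem_degreeOfLT {σ k : Type*} [CommSemiring k] {t : σ → ℕ} (ht : ∀ l, 0 < t l)
    {f : MvPolynomial σ k} : f ∈ degreeOfLT k t ↔ ∀ l, f.degreeOf l < t l := by
  simp only [degreeOfLT, mem_restrictSupport_iff, degreeOf_lt_iff (ht _)]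
  exact ⟨fun h l m hm => h hm l, fun h m hm l => h l m hm⟩

/-- Exponents bounded by `t` in each coordinate. -/
noncomputable def boundedExponentEquiv {σ : Type*} [Finite σ] (t : σ → ℕ) :
    {m : σ →₀ ℕ | ∀ l, m l < t l} ≃ (∀ l, Fin (t l)) where
  toFun m l := ⟨m.1 l, m.2 l⟩
  invFun a := ⟨Finsupp.equivFunOnFinite.symm fun l => a l, fun l => (a l).2⟩
  left_inv m := by ext; rfl
  right_inv a := by ext; rfl

/-- The monomial basis of `ℛ_t`. -/
noncomputable def degreeOfLTBasis {σ : Type*} [Finite σ] (k : Type*) [CommSemiring k]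
    (t : σ → ℕ) : Module.Basis (∀ l, Fin (t l)) k (degreeOfLT k t) :=
  (basisRestrictSupport k _).reindex (boundedExponentEquiv t)

theorem finrank_degreeOfLT {σ k : Type*} [Fintype σ] [Field k] (t : σ → ℕ) :
    Module.finrank k (degreeOfLT k t) = ∏ l, t l := by
  classical
  simp [Module.finrank_eq_card_basis (degreeOfLTBasis k t)]

theorem pow_eq_sum_mul_pow_sub_one {R : Type*} [CommRing R] (x : R) {m t j : ℕ}
    (hm : m < t * j) :
    x ^ m = ∑ y : Fin j, x ^ (m % t) * ((m / t).choose y : R) * (x ^ t - 1) ^ (y : ℕ) := by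
  have hq : m / t < j := Nat.div_lt_of_lt_mul hm
  rw [Fin.sum_univ_eq_sum_range
    (fun y => x ^ (m % t) * ((m / t).choose y : R) * (x ^ t - 1) ^ y) j,
    ← Finset.sum_subset (Finset.range_subset_range.2 (Nat.succ_le_of_lt hq))]
  · calc x ^ m = x ^ (m % t) * ((x ^ t - 1) + 1) ^ (m / t) := by
          rw [sub_add_cancel, ← pow_mul, ← pow_add, Nat.mod_add_div]
      _ = _ := by
          rw [add_pow, Finset.mul_sum]
          refine Finset.sum_congr rfl fun y _ => ?_
          rw [one_pow]
          ring
  · intro y _ hy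
    rw [Nat.choose_eq_zero_of_lt (by simpa using hy)]
    simp

theorem degreeOf_prod_X_pow_sub_one_le {σ k : Type*} [Fintype σ] [Field k] (t y : σ → ℕ)
    (l : σ) :
    (∏ i, ((X i : MvPolynomial σ k) ^ t i - 1) ^ y i).degreeOf l ≤ y l * t l := by
  classical
  refine (degreeOf_prod_le _ _ _).trans ?_
  rw [Finset.sum_eq_single l]
  · refine (degreeOf_pow_le _ _ _).trans (Nat.mul_le_mul_left _ ?_)
    refine (degreeOf_sub_le _ _ _).trans ?_
    simp [degreeOf_one]
  · intro i _ hi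
    refine Nat.le_zero.1 ((degreeOf_pow_le _ _ _).trans ?_)
    have h : ((X i : MvPolynomial σ k) ^ t i - 1).degreeOf l ≤ 0 := by
      refine (degreeOf_sub_le _ _ _).trans ?_
      simp [degreeOf_one, degreeOf_X_pow_of_ne _ hi.symm]
    simp [Nat.le_zero.1 h]
  · simp

theorem sum_mul_mem_degreeOfLT {σ k : Type*} [Fintype σ] [DecidableEq σ] [Field k]
    {t j : σ → ℕ} (ht : ∀ l, 0 < t l) (hj : ∀ l, 0 < j l)
    (c : (∀ l, Fin (j l)) → MvPolynomial σ k) (hc : ∀ y, c y ∈ degreeOfLT k t) :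
    ∑ y : ∀ l, Fin (j l), c y * ∏ l, (X l ^ t l - 1) ^ (y l : ℕ)
      ∈ degreeOfLT k fun l => t l * j l := by
  refine Submodule.sum_mem _ fun y _ => ?_
  rw [mem_degreeOfLT fun l => Nat.mul_pos (ht l) (hj l)]
  intro l
  have h₁ := (mem_degreeOfLT ht).1 (hc y) l
  have h₂ := degreeOf_prod_X_pow_sub_one_le (k := k) t (fun i => (y i : ℕ)) l
  calc _ ≤ _ := degreeOf_mul_le _ _ _
    _ < t l + y l * t l := by lia
    _ = t l * (y l + 1) := by ring
    _ ≤ t l * j l := Nat.mul_le_mul_left _ (y l).2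

/-- The map `(c_y)_y ↦ ∑_y c_y · 𝒴_t^y` from families in `ℛ_t` to `ℛ_{t∘j}`. -/
noncomputable def expansionMap {σ : Type*} (k : Type*) [Fintype σ] [DecidableEq σ] [Field k]
    {t j : σ → ℕ} (ht : ∀ l, 0 < t l) (hj : ∀ l, 0 < j l) :
    ((∀ l, Fin (j l)) → degreeOfLT k t) →ₗ[k] degreeOfLT k fun l => t l * j l where
  toFun c := ⟨∑ y : ∀ l, Fin (j l), (c y : MvPolynomial σ k) * ∏ l, (X l ^ t l - 1) ^ (y l : ℕ),
    sum_mul_mem_degreeOfLT ht hj _ fun y => (c y).2⟩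
  map_add' c d := by
    ext1
    simp [add_mul, Finset.sum_add_distrib]
  map_smul' a c := by
    ext1
    simp [Finset.smul_sum]

theorem expansionMap_surjective {σ k : Type*} [Fintype σ] [DecidableEq σ] [Field k]
    {t j : σ → ℕ} (ht : ∀ l, 0 < t l) (hj : ∀ l, 0 < j l) :
    Function.Surjective (expansionMap k ht hj) := by
  suffices h : (degreeOfLT k fun l => t l * j l) ≤
      (LinearMap.range (expansionMap k ht hj)).map (Submodule.subtype _) by
    intro f
    obtain ⟨_, ⟨c, rfl⟩, hc⟩ := h f.2
    exact ⟨c, Subtype.ext hc⟩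
  conv_lhs => rw [degreeOfLT, restrictSupport_eq_span]
  rw [Submodule.span_le]
  rintro _ ⟨m, hm, rfl⟩
  let r : σ →₀ ℕ := Finsupp.equivFunOnFinite.symm fun l => m l % t l
  refine ⟨_, ⟨fun y => ⟨monomial r (∏ l, ((m l / t l).choose (y l) : k)),
    (monomial_mem_restrictSupport k).2 (Or.inl fun l => Nat.mod_lt _ (ht l))⟩, rfl⟩, ?_⟩
  change ∑ y : ∀ l, Fin (j l), monomial r (∏ l, ((m l / t l).choose (y l) : k)) *
    ∏ l, (X l ^ t l - 1) ^ (y l : ℕ) = monomial m 1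
  rw [monomial_eq (s := m), C_1, one_mul, Finsupp.prod_fintype _ _ fun _ => pow_zero _,
    Finset.prod_congr rfl fun l _ => pow_eq_sum_mul_pow_sub_one (X l) (hm l),
    Finset.prod_univ_sum, Fintype.piFinset_univ]
  refine Finset.sum_congr rfl fun y _ => ?_
  rw [monomial_eq, Finsupp.prod_fintype _ _ fun _ => pow_zero _, Finset.prod_mul_distrib,
    Finset.prod_mul_distrib, map_prod, mul_comm (∏ l, C _)]
  simp [r]

theorem expansionMap_bijective {σ k : Type*} [Fintype σ] [DecidableEq σ] [Field k]
    {t j : σ → ℕ} (ht : ∀ l, 0 < t l) (hj : ∀ l, 0 < j l) :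
    Function.Bijective (expansionMap k ht hj) := by
  have hs := expansionMap_surjective (k := k) ht hj
  have (s : σ → ℕ) : Module.Finite k (degreeOfLT k s) := .of_basis (degreeOfLTBasis k s)
  refine ⟨(LinearMap.injective_iff_surjective_of_finrank_eq_finrank ?_).2 hs, hs⟩
  simp [Module.finrank_pi_fintype, finrank_degreeOfLT, Finset.prod_mul_distrib, mul_comm]

/-- `ℛ_{t∘j} = ⊕_{y ≪ j} ℛ_t·𝒴_t^y`: a polynomial `f` satisfies
`deg_{X_l}(f) < t_l·j_l` for all `l` if and only if it admits a (then unique)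
representation `f = ∑_{y ≪ j} c_y · 𝒴_t^y` with all `c_y ∈ ℛ_t`. -/
theorem stmt_3 {k : Type*} [Field k] {n : ℕ} (hn : 0 < n)
    (t j : Fin n → ℕ) (ht : ∀ l, 0 < t l) (hj : ∀ l, 0 < j l) :
    ∀ f : MvPolynomial (Fin n) k,
      (∀ l, f.degreeOf l < t l * j l) ↔
        ∃! c : (∀ l, Fin (j l)) → MvPolynomial (Fin n) k,
          (∀ y, ∀ l, (c y).degreeOf l < t l) ∧
          f = ∑ y : ∀ l, Fin (j l), c y * ∏ l, (X l ^ t l - 1) ^ (y l : ℕ) := by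
  intro f
  rw [← mem_degreeOfLT fun l => Nat.mul_pos (ht l) (hj l)]
  simp only [← mem_degreeOfLT ht]
  constructor
  · intro hf
    obtain ⟨c, hc, huniq⟩ := (expansionMap_bijective ht hj).existsUnique ⟨f, hf⟩
    refine ⟨fun y => c y, ⟨fun y => (c y).2, (congrArg Subtype.val hc).symm⟩, ?_⟩
    rintro d ⟨hd, hfd⟩
    rw [← huniq (fun y => ⟨d y, hd y⟩) (Subtype.ext hfd.symm)]
  · rintro ⟨c, ⟨hc, rfl⟩, -⟩
    exact sum_mul_mem_degreeOfLT ht hj c hc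
end

section
/- Let k be a field and G a group. The group algebra k[G] is both Artinian and Noetherian (as a module over itself) if and only if G is finite. -/
namespace MonoidAlgebra

variable {k G : Type*} [Field k] [Group G]

theorem isMulTorsion_of_isArtinianRing [IsArtinianRing (MonoidAlgebra k G)] :
    IsMulTorsion G := by
  intro g
  by_contra hg
  have hinj : Function.Injective fun n : ℕ ↦ g ^ n := injective_pow_iff_not_isOfFinOrder.mpr hg
  let a : MonoidAlgebra k G := single g 1 - 1
  have ha : Function.Injective (LinearMap.toSpanSingleton (MonoidAlgebra k G) _ a) := by
    rw [← LinearMap.ker_eq_bot, LinearMap.ker_eq_bot']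
    intro x hx
    replace hx : x * single g 1 = x := by
      simpa [a, mul_sub, sub_eq_zero] using hx
    by_contra hx0
    obtain ⟨h, hh⟩ : x.coeff.support.Nonempty := by
      simpa [Finsupp.support_nonempty_iff] using hx0
    have hstep (u : G) (hu : u ∈ x.coeff.support) : u * g ∈ x.coeff.support := by
      rw [Finsupp.mem_support_iff] at hu ⊢
      rw [← hx]
      simpa using hu
    have hall (n : ℕ) : h * g ^ n ∈ x.coeff.support := by
      induction n with
      | zero => simpa using hh
      | succ n ih => rw [pow_succ, ← mul_assoc]; exact hstep _ ih
    exact Set.infinite_of_injective_forall_mem ((mul_right_injective h).comp hinj) hall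
      x.coeff.support.finite_toSet
  obtain ⟨b, hb⟩ := IsArtinian.surjective_of_injective_endomorphism _ ha 1
  have := congr_arg (lift k k G (1 : G →* k)) hb
  simp [a] at this

open scoped Pointwise in
/-- The group algebra of a group without nontrivial elements having only finitely many conjugates
is a prime ring. -/
theorem exists_mul_mul_ne_zero
    (hG : ∀ g : G, (Subgroup.centralizer {g}).FiniteIndex → g = 1)
    {a b : MonoidAlgebra k G} (ha : a ≠ 0) (hb : b ≠ 0) : ∃ x, a * x * b ≠ 0 := by
  classical
  by_contra! h
  obtain ⟨u, hu⟩ : a.coeff.support.Nonempty := by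
    simpa [Finsupp.support_nonempty_iff] using ha
  obtain ⟨v, hv⟩ : b.coeff.support.Nonempty := by
    simpa [Finsupp.support_nonempty_iff] using hb
  have key (x : G) : ∃ s ∈ a.coeff.support, ∃ w ∈ b.coeff.support,
      v * w⁻¹ ≠ 1 ∧ x⁻¹ * (u⁻¹ * s) * x = v * w⁻¹ := by
    by_contra! hx
    have huniq : UniqueMul (a * single x 1).coeff.support b.coeff.support (u * x) v := by
      intro s w hs hw hsw
      have hs' : s * x⁻¹ ∈ a.coeff.support := by
        rw [Finsupp.mem_support_iff] at hs ⊢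
        simpa using hs
      have hvw : v * w⁻¹ = 1 := by
        by_contra hne
        refine hx _ hs' w hw hne ?_
        rw [mul_assoc, mul_assoc, inv_mul_cancel_right, eq_mul_inv_iff_mul_eq, mul_assoc,
          mul_assoc, hsw]
        group
      obtain rfl := mul_inv_eq_one.mp hvw
      exact ⟨mul_right_cancel hsw, rfl⟩
    have := coeff_mul_mul_of_uniqueMul huniq
    rw [h] at this
    rw [Finsupp.mem_support_iff] at hu hv
    simp [hu, hv] at this
  let t : Finset (G × G) :=
    (a.coeff.support ×ˢ b.coeff.support).filter fun p ↦ v * p.2⁻¹ ≠ 1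
  let c (p : G × G) : G :=
    if hp : ∃ x, x⁻¹ * (u⁻¹ * p.1) * x = v * p.2⁻¹ then hp.choose else 1
  have hcover : ⋃ p ∈ t, c p • (Subgroup.centralizer {v * p.2⁻¹} : Set G) = Set.univ := by
    rw [Set.eq_univ_iff_forall]
    intro x
    obtain ⟨s, hs, w, hw, hne, hx⟩ := key x
    simp only [Set.mem_iUnion]
    refine ⟨(s, w), by simp only [t, Finset.mem_filter, Finset.mem_product]; exact ⟨⟨hs, hw⟩, hne⟩,
      ?_⟩
    have hp : ∃ x, x⁻¹ * (u⁻¹ * s) * x = v * w⁻¹ := ⟨x, hx⟩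
    rw [mem_leftCoset_iff, SetLike.mem_coe, Subgroup.mem_centralizer_singleton_iff]
    simp only [c, dif_pos hp]
    have hy := hp.choose_spec
    generalize hp.choose = y at hy
    calc
      y⁻¹ * x * (v * w⁻¹) = y⁻¹ * (u⁻¹ * s) * y * (y⁻¹ * x) := by rw [← hx]; group
      _ = v * w⁻¹ * (y⁻¹ * x) := by rw [hy]
  obtain ⟨p, hp, hfin⟩ := Subgroup.exists_finiteIndex_of_leftCoset_cover hcover
  exact (Finset.mem_filter.mp hp).2 (hG _ hfin)

/-- If `k[G]` is Artinian and no nontrivial element of `G` has only finitely many conjugates,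
then `k[G]` is semisimple and prime, so its augmentation ideal vanishes. -/
theorem subsingleton_of_isArtinianRing [IsArtinianRing (MonoidAlgebra k G)]
    (hG : ∀ g : G, (Subgroup.centralizer {g}).FiniteIndex → g = 1) : Subsingleton G := by
  have hpow (I : Ideal (MonoidAlgebra k G)) (hI : I ≠ ⊥) (n : ℕ) : I ^ n ≠ ⊥ := by
    induction n with
    | zero =>
      rw [Submodule.pow_zero]
      exact fun h ↦ top_ne_bot (Ideal.one_eq_top.symm.trans h)
    | succ n ih =>
      obtain ⟨a, ha, ha0⟩ := Submodule.exists_mem_ne_zero_of_ne_bot ih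
      obtain ⟨b, hb, hb0⟩ := Submodule.exists_mem_ne_zero_of_ne_bot hI
      obtain ⟨x, hx⟩ := exists_mul_mul_ne_zero hG ha0 hb0
      refine Submodule.ne_bot_iff _ |>.mpr ⟨a * x * b, ?_, hx⟩
      rw [Submodule.pow_succ, mul_assoc]
      exact Ideal.mul_mem_mul ha (I.mul_mem_left x hb)
  have hss : IsSemisimpleRing (MonoidAlgebra k G) := by
    rw [IsArtinianRing.isSemisimpleRing_iff_jacobson]
    by_contra hJ
    obtain ⟨n, hn⟩ := IsSemiprimaryRing.isNilpotent (R := MonoidAlgebra k G)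
    exact hpow _ hJ n hn
  let ε : MonoidAlgebra k G →+* k := (lift k k G (1 : G →* k) : MonoidAlgebra k G →ₐ[k] k)
  obtain ⟨e, he, hspan⟩ := IsSemisimpleRing.ideal_eq_span_idempotent (RingHom.ker ε)
  have hεe : ε e = 0 := by
    rw [← RingHom.mem_ker, hspan]
    exact Ideal.mem_span_singleton_self e
  have hzero (x : MonoidAlgebra k G) (hx : ε x = 0) : x * (1 - e) = 0 := by
    rw [← RingHom.mem_ker, hspan, Ideal.mem_span_singleton'] at hx
    obtain ⟨y, rfl⟩ := hx
    rw [mul_assoc, mul_sub, he.eq, mul_one, sub_self, mul_zero]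
  have he1 : 1 - e ≠ 0 := fun h ↦ by simpa [hεe] using congr_arg ε h
  refine subsingleton_of_forall_eq 1 fun g ↦ ?_
  by_contra hg
  have ha : (single g 1 - 1 : MonoidAlgebra k G) ≠ 0 := by
    rw [sub_ne_zero, one_def]
    exact (single_left_inj one_ne_zero).not.mpr hg
  obtain ⟨x, hx⟩ := exists_mul_mul_ne_zero hG ha he1
  exact hx (hzero _ (by simp [ε]))

end MonoidAlgebra

theorem Subgroup.finite_normalClosure_singleton {G : Type*} [Group G] (htor : IsMulTorsion G)
    (g : G) [(Subgroup.centralizer {g}).FiniteIndex] :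
    Finite (Subgroup.normalClosure {g}) := by
  have hconj : (Group.conjugatesOfSet {g}).Finite := by
    have : Group.conjugatesOfSet {g} ⊆
        Set.range fun q : G ⧸ Subgroup.centralizer {g} ↦ q.out * g * q.out⁻¹ := by
      intro x hx
      obtain ⟨y, rfl⟩ : ∃ y, y * g * y⁻¹ = x := by
        simpa [Group.conjugatesOfSet, conjugatesOf, isConj_iff] using hx
      refine ⟨y, ?_⟩
      obtain ⟨⟨z, hz⟩, h⟩ := QuotientGroup.mk_out_eq_mul (Subgroup.centralizer {g}) y
      rw [Subgroup.mem_centralizer_singleton_iff] at hz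
      simp only [h, mul_inv_rev]
      rw [mul_assoc y z g, hz]
      group
    exact (Set.finite_range _).subset this
  let N := Subgroup.normalClosure {g}
  have : Group.FG N := (Group.fg_iff_subgroup_fg N).mpr
    ⟨hconj.toFinset, by simp [N, Subgroup.normalClosure]⟩
  let K := (Subgroup.centralizer {g}).normalCore
  have hKN : K ≤ Subgroup.centralizer (N : Set G) := by
    rw [← Subgroup.le_centralizer_iff]
    exact Subgroup.normalClosure_le_normal (Set.singleton_subset_iff.mpr <|
      Subgroup.mem_centralizer_iff.mpr fun x hx ↦
        Subgroup.mem_centralizer_singleton_iff.mp (Subgroup.normalCore_le _ hx))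
  let A := K.subgroupOf N
  let : CommGroup A := { mul_comm := fun x y ↦ Subtype.ext <| Subtype.ext <|
    (Subgroup.mem_centralizer_iff.mp (hKN y.2) _ x.1.2) }
  have : Finite A := CommGroup.finite_of_fg_isMulTorsion A fun x ↦
    Submonoid.isOfFinOrder_coe.mp (Submonoid.isOfFinOrder_coe.mp (htor (x : G)))
  have : Finite (N ⧸ A) := Subgroup.finite_quotient_of_finiteIndex
  exact Finite.of_subgroup_quotient A

theorem MonoidAlgebra.exists_maximal_finite_normal (k G : Type*) [Field k] [Group G]
    [IsNoetherianRing (MonoidAlgebra k G)] :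
    ∃ N : Subgroup G, Maximal (fun H : Subgroup G ↦ H.Normal ∧ Finite H) N := by
  let S := {H : Subgroup G // H.Normal ∧ Finite H}
  let I (H : S) : Ideal (MonoidAlgebra k G) :=
    haveI := H.2.1
    RingHom.ker (mapDomainRingHom k (QuotientGroup.mk' H.1))
  have hI (H : S) (g : G) : single g 1 - 1 ∈ I H ↔ g ∈ H.1 := by
    have := H.2.1
    simp only [I, RingHom.mem_ker, map_sub, map_one, sub_eq_zero]
    simp [one_def, single_left_inj]
  have hmono (H K : S) (h : H ≤ K) : I H ≤ I K := by
    have := H.2.1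
    have := K.2.1
    have hcomp : QuotientGroup.mk' K.1 = (QuotientGroup.map H.1 K.1 (.id G) h).comp
      (QuotientGroup.mk' H.1) := by ext; rfl
    intro x hx
    simp only [I, RingHom.mem_ker] at hx ⊢
    rw [hcomp, mapDomainRingHom_comp, RingHom.comp_apply, hx, map_zero]
  obtain ⟨N, -, hN⟩ := (InvImage.wf I (wellFounded_gt (α := Ideal (MonoidAlgebra k G)))).has_min
    Set.univ ⟨⟨⊥, inferInstance, inferInstance⟩, trivial⟩
  refine ⟨N, N.2, fun H hH hle g hg ↦ ?_⟩
  have := eq_of_le_of_not_lt (hmono N ⟨H, hH⟩ hle) (hN ⟨H, hH⟩ trivial)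
  rw [← hI, this, hI]
  exact hg

/-- the group algebra `k[G]` is both Artinian and Noetherian (as a module
over itself) if and only if the group `G` is finite. -/
theorem stmt_4 {k G : Type*} [Field k] [Group G] :
    (IsArtinianRing (MonoidAlgebra k G) ∧ IsNoetherianRing (MonoidAlgebra k G)) ↔
      Finite G := by
  refine ⟨fun ⟨_, _⟩ ↦ ?_, fun _ ↦ ?_⟩
  · obtain ⟨N, ⟨_, _⟩, hmax⟩ := MonoidAlgebra.exists_maximal_finite_normal k G
    have : IsArtinianRing (MonoidAlgebra k (G ⧸ N)) := by
      refine Function.Surjective.isArtinianRing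
        (f := MonoidAlgebra.mapDomainRingHom k (QuotientGroup.mk' N)) fun x ↦ ?_
      induction x using MonoidAlgebra.induction_linear with
      | zero => exact ⟨0, map_zero _⟩
      | add x y hx hy =>
        obtain ⟨x, rfl⟩ := hx
        obtain ⟨y, rfl⟩ := hy
        exact ⟨x + y, map_add _ _ _⟩
      | single m r =>
        obtain ⟨g, rfl⟩ := QuotientGroup.mk'_surjective N m
        exact ⟨.single g r, by simp⟩
    have hsub : Subsingleton (G ⧸ N) := by
      refine MonoidAlgebra.subsingleton_of_isArtinianRing (k := k) fun q hq ↦ ?_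
      have := Subgroup.finite_normalClosure_singleton
        (MonoidAlgebra.isMulTorsion_of_isArtinianRing (k := k)) q
      let M := (Subgroup.normalClosure {q}).comap (QuotientGroup.mk' N)
      have hNM : N ≤ M := fun x hx ↦ by
        simp [M, (QuotientGroup.eq_one_iff x).mpr hx]
      have hM : Finite M := by
        have hfin : (Subgroup.normalClosure {q} : Set (G ⧸ N)).Finite := Set.toFinite _
        refine (hfin.preimage' (f := QuotientGroup.mk' N) fun b _ ↦ ?_).to_subtype
        obtain ⟨g, rfl⟩ := QuotientGroup.mk'_surjective N b
        refine (((N : Set G).toFinite).image (g * ·)).subset fun x hx ↦ ?_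
        exact ⟨g⁻¹ * x, QuotientGroup.eq.mp (Eq.symm hx), mul_inv_cancel_left g x⟩
      have hMN := hmax ⟨inferInstance, hM⟩ hNM
      obtain ⟨g, rfl⟩ := QuotientGroup.mk'_surjective N q
      exact (QuotientGroup.eq_one_iff g).mpr (hMN (Subgroup.subset_normalClosure rfl))
    exact Finite.of_subgroup_quotient N
  · have : Module.Finite k (MonoidAlgebra k G) := inferInstance
    exact ⟨IsArtinianRing.of_finite k _, IsNoetherianRing.of_finite k _⟩
end

section
/- Let k be a field and m = (m_1,...,m_n) an n-tuple of positive integers each coprime to the characteristic of k, so that 𝒞_{m/k} is semisimple. Let k̄ be an algebraic closure of k, let the group of k-algebra automorphisms of k̄ act coordinatewise on the vanishing set 𝒱(𝔞_m) ⊆ k̄^n, and let S ⊆ 𝒱(𝔞_m) be a set containing exactly one representative of each orbit of this action. For x = (x_1,...,x_n) ∈ S let k(x) denote the subfield of k̄ generated over k by x_1,...,x_n. Then the map 𝒞_{m/k} → ⊕_{x ∈ S} k(x) sending (the class of) f to the tuple (f(x))_{x ∈ S} of evaluations is a ring isomorphism. -/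
open MvPolynomial

/-- The kernel of evaluation at a point with algebraic coordinates is a maximal ideal. -/
theorem MvPolynomial.ker_aeval_isMaximal {k K σ : Type*} [Field k] [Field K] [Algebra k K]
    [Algebra.IsAlgebraic k K] (x : σ → K) :
    (RingHom.ker (aeval x : MvPolynomial σ k →ₐ[k] K)).IsMaximal := by
  have h_integral : (aeval x : MvPolynomial σ k →ₐ[k] K).toRingHom.IsIntegral := by
    apply RingHom.IsIntegral.tower_top (algebraMap k (MvPolynomial σ k))
    rw [AlgHom.toRingHom_eq_coe, AlgHom.comp_algebraMap]
    exact fun z => Algebra.IsIntegral.isIntegral z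
  exact Ideal.isMaximal_comap_of_isIntegral_of_isMaximal' _ h_integral ⊥

/-- In a normal extension, points with the same kernel of evaluation are conjugate. -/
theorem MvPolynomial.exists_algEquiv_of_ker_aeval_eq {k K σ : Type*} [Field k] [Field K]
    [Algebra k K] [Normal k K] {x y : σ → K}
    (h : RingHom.ker (aeval x : MvPolynomial σ k →ₐ[k] K) =
      RingHom.ker (aeval y : MvPolynomial σ k →ₐ[k] K)) :
    ∃ τ : K ≃ₐ[k] K, (fun i => τ (x i)) = y := by
  have hmax := ker_aeval_isMaximal (k := k) x
  let := Ideal.Quotient.field (RingHom.ker (aeval x : MvPolynomial σ k →ₐ[k] K))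
  let f := Ideal.kerLiftAlg (aeval x : MvPolynomial σ k →ₐ[k] K)
  let g : (MvPolynomial σ k ⧸ RingHom.ker (aeval x : MvPolynomial σ k →ₐ[k] K)) →ₐ[k] K :=
    Ideal.Quotient.liftₐ _ (aeval y) fun a ha => by rwa [h] at ha
  let φ : f.fieldRange →ₐ[k] K := g.comp (AlgEquiv.ofInjectiveField f).symm.toAlgHom
  obtain ⟨ψ, hψ⟩ := IntermediateField.exists_algHom_of_splits
    (fun s => ⟨Normal.isIntegral ‹_› s, Normal.splits ‹_› s⟩) φ
  refine ⟨AlgEquiv.ofBijective ψ (AlgHom.normal_bijective k K K ψ), ?_⟩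
  funext i
  have hx : x i = ((AlgEquiv.ofInjectiveField f (Ideal.Quotient.mk _ (X i)) :
      f.fieldRange) : K) := by
    change x i = aeval x (X i)
    simp
  have := DFunLike.congr_fun hψ (AlgEquiv.ofInjectiveField f (Ideal.Quotient.mk _ (X i)))
  change ψ (x i) = y i
  rw [hx]
  refine this.trans ?_
  change g ((AlgEquiv.ofInjectiveField f).symm (AlgEquiv.ofInjectiveField f _)) = _
  rw [AlgEquiv.symm_apply_apply]
  change aeval y (X i) = _
  simp

/-- The cyclotomic ideal is radical if its exponents are nonzero in the base field. -/
theorem MvPolynomial.isRadical_span_X_pow_sub_one {k : Type*} [Field k] {σ : Type*} [Finite σ]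
    (m : σ → ℕ) (hm : ∀ i, (m i : k) ≠ 0) :
    (Ideal.span (Set.range fun i => (X i : MvPolynomial σ k) ^ m i - 1)).IsRadical := by
  set I := Ideal.span (Set.range fun i => (X i : MvPolynomial σ k) ^ m i - 1)
  rw [Ideal.isRadical_iff_quotient_reduced]
  have hX (i : σ) : (Ideal.Quotient.mk I (X i)) ^ m i = 1 := by
    rw [← map_pow, ← map_one (Ideal.Quotient.mk I), Ideal.Quotient.mk_eq_mk_iff_sub_mem]
    exact Ideal.subset_span ⟨i, rfl⟩
  have hD (i : σ) : KaehlerDifferential.D k (MvPolynomial σ k ⧸ I)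
      (Ideal.Quotient.mk I (X i)) = 0 := by
    have h := congrArg (KaehlerDifferential.D k (MvPolynomial σ k ⧸ I)) (hX i)
    rw [Derivation.leibniz_pow, Derivation.map_one_eq_zero] at h
    have hm0 : m i ≠ 0 := fun h0 => hm i (by simp [h0])
    have hu : IsUnit (Ideal.Quotient.mk I (X i)) := .of_pow_eq_one (hX i) hm0
    rw [← Nat.cast_smul_eq_nsmul k, (IsUnit.mk0 _ (hm i)).smul_eq_zero,
      (hu.pow _).smul_eq_zero] at h
    exact h
  have hunr : Algebra.FormallyUnramified k (MvPolynomial σ k ⧸ I) := by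
    refine ⟨⟨fun a b => ?_⟩⟩
    have hD0 : KaehlerDifferential.D k (MvPolynomial σ k ⧸ I) = 0 := by
      refine Derivation.ext fun a => ?_
      obtain ⟨p, rfl⟩ := Ideal.Quotient.mk_surjective a
      induction p using MvPolynomial.induction_on with
      | C c => exact Derivation.map_algebraMap _ c
      | add p q hp hq => simp_all
      | mul_X p i hp => simp [hp, hD i]
    have hspan := KaehlerDifferential.span_range_derivation k (MvPolynomial σ k ⧸ I)
    have htop : (⊤ : Submodule (MvPolynomial σ k ⧸ I) Ω[(MvPolynomial σ k ⧸ I)⁄k]) = ⊥ := by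
      rw [← hspan, hD0, Submodule.span_eq_bot]
      rintro _ ⟨_, rfl⟩
      rfl
    have h0 (c : Ω[(MvPolynomial σ k ⧸ I)⁄k]) : c = 0 := by
      rw [← Submodule.mem_bot (MvPolynomial σ k ⧸ I), ← htop]
      trivial
    rw [h0 a, h0 b]
  exact Algebra.FormallyUnramified.isReduced_of_field k _

/-- semisimple ring decomposition: if each `m_i` is coprime to the
characteristic of `k` and `S` is a set of representatives of the orbits of the
coordinatewise action of the `k`-algebra automorphisms of `k̄` on the vanishing set
`𝒱(𝔞_m)`, then evaluation at the points of `S` gives a ring isomorphism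
`𝒞_{m/k} ≅ ⊕_{x ∈ S} k(x)`. -/
theorem stmt_10 {k : Type*} [Field k] {n : ℕ} (m : Fin n → ℕ) (hm : ∀ i, 0 < m i)
    (hcop : ∀ i, ¬ (ringChar k ∣ m i))
    (S : Set (Fin n → AlgebraicClosure k))
    (hSV : ∀ x ∈ S, ∀ f ∈ Ideal.span
        (Set.range fun i => (X i : MvPolynomial (Fin n) k) ^ m i - 1),
        MvPolynomial.aeval x f = 0)
    (hrep : ∀ x : Fin n → AlgebraicClosure k,
      (∀ f ∈ Ideal.span
          (Set.range fun i => (X i : MvPolynomial (Fin n) k) ^ m i - 1),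
          MvPolynomial.aeval x f = 0) →
      ∃! s, s ∈ S ∧ ∃ σ : AlgebraicClosure k ≃ₐ[k] AlgebraicClosure k,
        (fun i => σ (x i)) = s) :
    ∃ e : (MvPolynomial (Fin n) k ⧸
          Ideal.span (Set.range fun i => (X i : MvPolynomial (Fin n) k) ^ m i - 1)) ≃+*
        (∀ s : S, Algebra.adjoin k (Set.range (s : Fin n → AlgebraicClosure k))),
      ∀ (f : MvPolynomial (Fin n) k) (s : S),
        ((e (Ideal.Quotient.mk _ f)) s : AlgebraicClosure k) =
          MvPolynomial.aeval (s : Fin n → AlgebraicClosure k) f := by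
  have hrad := isRadical_span_X_pow_sub_one (k := k) m fun i h0 =>
    hcop i ((ringChar.spec k (m i)).mp h0)
  have hgen (i : Fin n) : (X i : MvPolynomial (Fin n) k) ^ m i - 1 ∈ Ideal.span
      (Set.range fun i => (X i : MvPolynomial (Fin n) k) ^ m i - 1) :=
    Ideal.subset_span ⟨i, rfl⟩
  set I := Ideal.span (Set.range fun i => (X i : MvPolynomial (Fin n) k) ^ m i - 1)
  have hfin : Finite S := by
    refine ((Set.Finite.pi fun i => (Polynomial.nthRootsFinset (m i)
      (1 : AlgebraicClosure k)).finite_toSet).subset fun x hx i _ => ?_).to_subtype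
    have := hSV x hx _ (hgen i)
    simpa [Polynomial.mem_nthRootsFinset (hm i), sub_eq_zero] using this
  let ev (s : S) : MvPolynomial (Fin n) k →+*
      Algebra.adjoin k (Set.range (s : Fin n → AlgebraicClosure k)) :=
    ((aeval (s : Fin n → AlgebraicClosure k)).codRestrict _ fun p => by
      rw [Algebra.adjoin_range_eq_range_aeval]
      exact ⟨p, rfl⟩).toRingHom
  let φ := Ideal.Quotient.lift I (RingHom.pi ev) fun a ha =>
    funext fun s => Subtype.ext (hSV s s.2 a ha)
  have hφ (p) (s : S) : (φ (Ideal.Quotient.mk I p) s : AlgebraicClosure k) =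
      aeval (s : Fin n → _) p := rfl
  have hinj : Function.Injective φ := by
    rw [injective_iff_map_eq_zero]
    intro a ha
    obtain ⟨p, rfl⟩ := Ideal.Quotient.mk_surjective a
    rw [Ideal.Quotient.eq_zero_iff_mem, ← hrad.radical,
      ← vanishingIdeal_zeroLocus_eq_radical (K := AlgebraicClosure k), mem_vanishingIdeal_iff]
    intro x hx
    obtain ⟨s, ⟨hs, τ, rfl⟩, -⟩ := hrep x hx
    have h0 := hφ p ⟨_, hs⟩
    rw [ha] at h0
    have hτ : aeval (fun i => τ (x i)) p = τ (aeval x p) := by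
      rw [← AlgEquiv.coe_toAlgHom, ← comp_aeval_apply]
    apply τ.injective
    rw [map_zero, ← hτ]
    exact h0.symm
  have hsurj : Function.Surjective φ := by
    have hcoprime : Pairwise (Function.onFun IsCoprime fun s : S =>
        RingHom.ker (aeval (s : Fin n → AlgebraicClosure k) :
          MvPolynomial (Fin n) k →ₐ[k] AlgebraicClosure k)) := by
      intro s t hst
      have hs := ker_aeval_isMaximal (k := k) (s : Fin n → AlgebraicClosure k)
      have ht := ker_aeval_isMaximal (k := k) (t : Fin n → AlgebraicClosure k)
      refine Ideal.isCoprime_of_isMaximal fun h => hst ?_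
      obtain ⟨τ, hτ⟩ := exists_algEquiv_of_ker_aeval_eq h
      exact Subtype.ext ((hrep s (hSV s s.2)).unique ⟨s.2, .refl, rfl⟩ ⟨t.2, τ, hτ⟩)
    intro y
    have hy (s : S) : ∃ p : MvPolynomial (Fin n) k,
        aeval (s : Fin n → AlgebraicClosure k) p = (y s : AlgebraicClosure k) :=
      (Algebra.adjoin_range_eq_range_aeval k (s : Fin n → AlgebraicClosure k)).le (y s).2
    choose p hp using hy
    obtain ⟨r, hr⟩ := Ideal.exists_forall_sub_mem_ideal hcoprime p
    refine ⟨Ideal.Quotient.mk I r, funext fun s => Subtype.ext ?_⟩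
    rw [hφ, ← hp s, ← sub_eq_zero, ← map_sub]
    exact hr s
  exact ⟨RingEquiv.ofBijective φ ⟨hinj, hsurj⟩, hφ⟩
end

section
/- Let k be a field of prime characteristic p and m = (m_1,...,m_n) an n-tuple of positive integers. Then the Jacobson radical of the circulant ring 𝒞_{m/k} equals the image of the ideal 𝔞_{r_p(m)} under the quotient map k[X_1,...,X_n] → 𝒞_{m/k}, i.e. Jac(𝒞_{m/k}) = 𝔞_{r_p(m)}/𝔞_m. -/
set_option synthInstance.maxHeartbeats 1000000
set_option maxHeartbeats 1000000

open MvPolynomial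

namespace MvPolynomial

variable {k σ : Type*} [Field k]

/-- The quotient of a polynomial ring by the polynomials `X i ^ r i - 1` with all `r i` invertible
in the base field is formally unramified. -/
theorem formallyUnramified_quotient_span_X_pow_sub_one (r : σ → ℕ) (hr : ∀ i, (r i : k) ≠ 0) :
    Algebra.FormallyUnramified k (MvPolynomial σ k ⧸
      Ideal.span (Set.range fun i => (X i : MvPolynomial σ k) ^ r i - 1)) := by
  set I := Ideal.span (Set.range fun i => (X i : MvPolynomial σ k) ^ r i - 1)
  refine Algebra.FormallyUnramified.iff_comp_injective.mpr ?_
  intro B _ _ J hJ f g hfg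
  refine Ideal.Quotient.algHom_ext k (MvPolynomial.algHom_ext fun i => ?_)
  set x := Ideal.Quotient.mkₐ k I (X i)
  have hx : x ^ r i = 1 := by
    rw [← map_pow, ← sub_eq_zero, ← map_one (Ideal.Quotient.mkₐ k I), ← map_sub]
    exact Ideal.Quotient.eq_zero_iff_mem.mpr (Ideal.subset_span ⟨i, rfl⟩)
  have hf : f x ^ r i = 1 := by rw [← map_pow, hx, map_one]
  have hg : g x ^ r i = 1 := by rw [← map_pow, hx, map_one]
  have hd : f x - g x ∈ J := Ideal.Quotient.eq.mp (DFunLike.congr_fun hfg x)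
  have hd2 : (f x - g x) ^ 2 = 0 := by
    have h := Ideal.pow_mem_pow hd 2
    rwa [hJ, Ideal.mem_bot] at h
  obtain ⟨c, hc⟩ := Polynomial.powAddExpansion (g x) (f x - g x) (r i)
  rw [add_sub_cancel, hf, hg, hd2, mul_zero, add_zero, left_eq_add] at hc
  have hr0 : r i ≠ 0 := fun h => hr i (by rw [h, Nat.cast_zero])
  have hz : (r i : k) • (f x - g x) = 0 := by
    rw [Algebra.smul_def, map_natCast]
    calc (r i : B) * (f x - g x) = g x ^ (r i - 1 + 1) * (r i * (f x - g x)) := by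
          rw [Nat.sub_add_cancel (Nat.pos_of_ne_zero hr0), hg, one_mul]
      _ = g x * (r i * g x ^ (r i - 1) * (f x - g x)) := by ring
      _ = 0 := by rw [hc, mul_zero]
  exact sub_eq_zero.mp ((smul_eq_zero_iff_right (hr i)).mp hz)

end MvPolynomial

/-- the Jacobson radical of the circulant ring `𝒞_{m/k}` over a field of
prime characteristic `p` is the image of `𝔞_{r_p(m)}` in `𝒞_{m/k}`. -/
theorem stmt_12 {k : Type*} [Field k] {p : ℕ} (hp : p.Prime) [CharP k p]
    {n : ℕ} (m : Fin n → ℕ) (hm : ∀ i, 0 < m i) :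
    (⊥ : Ideal (MvPolynomial (Fin n) k ⧸
        Ideal.span (Set.range fun i => (X i : MvPolynomial (Fin n) k) ^ m i - 1))).jacobson =
      Ideal.map
        (Ideal.Quotient.mk
          (Ideal.span (Set.range fun i => (X i : MvPolynomial (Fin n) k) ^ m i - 1)))
        (Ideal.span (Set.range fun i =>
          (X i : MvPolynomial (Fin n) k) ^ (m i / p ^ (m i).factorization p) - 1)) := by
  have := Fact.mk hp
  set A := Ideal.span (Set.range fun i => (X i : MvPolynomial (Fin n) k) ^ m i - 1)
  set R := Ideal.span (Set.range fun i =>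
    (X i : MvPolynomial (Fin n) k) ^ (m i / p ^ (m i).factorization p) - 1) with hR
  have hpow (i : Fin n) : ((X i : MvPolynomial (Fin n) k) ^
      (m i / p ^ (m i).factorization p) - 1) ^ p ^ (m i).factorization p = X i ^ m i - 1 := by
    rw [sub_pow_char_pow, one_pow, ← pow_mul, mul_comm, Nat.ordProj_mul_ordCompl_eq_self]
  have hAR : A ≤ R := by
    rw [Ideal.span_le]
    rintro _ ⟨i, rfl⟩
    beta_reduce
    rw [SetLike.mem_coe, ← hpow]
    exact R.pow_mem_of_mem (Ideal.subset_span (Set.mem_range_self i)) _ (Nat.ordProj_pos _ _)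
  have hRad : R.IsRadical := by
    have := formallyUnramified_quotient_span_X_pow_sub_one (k := k)
      (fun i => m i / p ^ (m i).factorization p) fun i h =>
        Nat.not_dvd_ordCompl hp (hm i).ne' ((CharP.cast_eq_zero_iff k p _).mp h)
    rw [Ideal.isRadical_iff_quotient_reduced]
    exact Algebra.FormallyUnramified.isReduced_of_field k _
  rw [← Ideal.radical_eq_jacobson]
  apply le_antisymm
  · calc (⊥ : Ideal (MvPolynomial (Fin n) k ⧸ A)).radical
        ≤ (R.map (Ideal.Quotient.mk A)).radical := Ideal.radical_mono bot_le
      _ = R.map (Ideal.Quotient.mk A) := by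
        rw [← Ideal.map_radical_of_surjective Ideal.Quotient.mk_surjective
          (by rwa [Ideal.mk_ker]), hRad.radical]
  · rw [hR, Ideal.map_span, Ideal.span_le]
    rintro _ ⟨_, ⟨i, rfl⟩, rfl⟩
    refine ⟨p ^ (m i).factorization p, ?_⟩
    rw [← map_pow, hpow]
    exact Ideal.Quotient.eq_zero_iff_mem.mpr (Ideal.subset_span ⟨i, rfl⟩)
end

section
/- Let k be a field of prime characteristic p, m = (m_1,...,m_n) an n-tuple of positive integers, and t a positive integer satisfying p^t ≡ 1 (mod r_p(m_i)) for all 1 ≤ i ≤ n and t ≥ Σ_{i=1}^n v_p(m_i) (such a t exists). Then the k-algebra endomorphism of k[X_1,...,X_n] determined by X_i ↦ X_i^{p^t} descends to a well-defined ring homomorphism σ : 𝒞_{r_p(m)/k} → 𝒞_{m/k}, and σ is a section of the natural projection π : 𝒞_{m/k} → 𝒞_{r_p(m)/k} (induced by the inclusion 𝔞_m ⊆ 𝔞_{r_p(m)}), i.e. π ∘ σ is the identity on 𝒞_{r_p(m)/k}; in particular σ is injective. -/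
set_option synthInstance.maxHeartbeats 1000000
set_option maxHeartbeats 1000000

open MvPolynomial

/-- The ideal generated by the `X i ^ m i - 1` contains `X i ^ a - 1` for every multiple `a`
of `m i`. -/
theorem X_pow_sub_one_mem_span_of_dvd {k ι : Type*} [CommRing k] (m : ι → ℕ) (i : ι) {a : ℕ}
    (h : m i ∣ a) :
    (X i : MvPolynomial ι k) ^ a - 1 ∈
      Ideal.span (Set.range fun i => (X i : MvPolynomial ι k) ^ m i - 1) := by
  obtain ⟨c, rfl⟩ := h
  refine Ideal.mem_of_dvd _ ?_ (Ideal.subset_span ⟨i, rfl⟩)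
  simpa only [pow_mul, one_pow] using sub_dvd_pow_sub_pow ((X i : MvPolynomial ι k) ^ m i) 1 c

/-- the substitution `X_i ↦ X_i^{p^t}` descends to a ring homomorphism
`σ : 𝒞_{r_p(m)/k} → 𝒞_{m/k}` which is a section of the natural projection
`π : 𝒞_{m/k} → 𝒞_{r_p(m)/k}`; in particular `σ` is injective. -/
theorem stmt_15 {k : Type*} [Field k] {p : ℕ} (hp : p.Prime) [CharP k p]
    {n : ℕ} (m : Fin n → ℕ) (hm : ∀ i, 0 < m i)
    (t : ℕ) (ht0 : 0 < t)
    (ht1 : ∀ i, p ^ t ≡ 1 [MOD m i / p ^ (m i).factorization p])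
    (ht2 : (∑ i, (m i).factorization p) ≤ t) :
    ∃ (σ : (MvPolynomial (Fin n) k ⧸
          Ideal.span (Set.range fun i =>
            (X i : MvPolynomial (Fin n) k) ^ (m i / p ^ (m i).factorization p) - 1)) →+*
        (MvPolynomial (Fin n) k ⧸
          Ideal.span (Set.range fun i => (X i : MvPolynomial (Fin n) k) ^ m i - 1)))
      (π : (MvPolynomial (Fin n) k ⧸
          Ideal.span (Set.range fun i => (X i : MvPolynomial (Fin n) k) ^ m i - 1)) →+*
        (MvPolynomial (Fin n) k ⧸
          Ideal.span (Set.range fun i =>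
            (X i : MvPolynomial (Fin n) k) ^ (m i / p ^ (m i).factorization p) - 1))),
      (∀ f : MvPolynomial (Fin n) k,
        σ (Ideal.Quotient.mk _ f) =
          Ideal.Quotient.mk _
            (MvPolynomial.aeval (fun i => (X i : MvPolynomial (Fin n) k) ^ p ^ t) f)) ∧
      (∀ f : MvPolynomial (Fin n) k,
        π (Ideal.Quotient.mk _ f) = Ideal.Quotient.mk _ f) ∧
      (∀ y, π (σ y) = y) ∧
      Function.Injective σ := by
  have hdvd (i : Fin n) : m i ∣ p ^ t * (m i / p ^ (m i).factorization p) := by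
    have hv : (m i).factorization p ≤ t :=
      (Finset.single_le_sum (f := fun i => (m i).factorization p)
        (fun _ _ => Nat.zero_le _) (Finset.mem_univ i)).trans ht2
    calc m i = p ^ (m i).factorization p * (m i / p ^ (m i).factorization p) :=
          (Nat.ordProj_mul_ordCompl_eq_self (m i) p).symm
      _ ∣ _ := mul_dvd_mul_right (pow_dvd_pow p hv) _
  let I := Ideal.span (Set.range fun i => (X i : MvPolynomial (Fin n) k) ^ m i - 1)
  let J := Ideal.span (Set.range fun i =>
    (X i : MvPolynomial (Fin n) k) ^ (m i / p ^ (m i).factorization p) - 1)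
  let φ : MvPolynomial (Fin n) k →ₐ[k] MvPolynomial (Fin n) k :=
    MvPolynomial.aeval fun i => (X i : MvPolynomial (Fin n) k) ^ p ^ t
  have hJ : J ≤ I.comap φ := by
    refine Ideal.span_le.2 ?_
    rintro _ ⟨i, rfl⟩
    simpa [φ, ← pow_mul] using X_pow_sub_one_mem_span_of_dvd (k := k) m i (hdvd i)
  have hI : I ≤ J := by
    refine Ideal.span_le.2 ?_
    rintro _ ⟨i, rfl⟩
    exact X_pow_sub_one_mem_span_of_dvd (fun i => m i / p ^ (m i).factorization p) i
      (Nat.ordCompl_dvd (m i) p)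
  have hφ : (Ideal.Quotient.mkₐ k J).comp φ = Ideal.Quotient.mkₐ k J := by
    refine MvPolynomial.algHom_ext fun i => ?_
    have hX : (Ideal.Quotient.mk J (X i)) ^ (m i / p ^ (m i).factorization p) = 1 := by
      rw [← map_pow, ← map_one (Ideal.Quotient.mk J), Ideal.Quotient.eq]
      exact Ideal.subset_span ⟨i, rfl⟩
    simpa [φ] using pow_eq_pow_of_modEq (ht1 i) hX
  have hsection (y : MvPolynomial (Fin n) k ⧸ J) :
      Ideal.Quotient.factor hI (Ideal.quotientMap I φ.toRingHom hJ y) = y := by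
    obtain ⟨f, rfl⟩ := Ideal.Quotient.mk_surjective y
    exact DFunLike.congr_fun hφ f
  exact ⟨Ideal.quotientMap I φ.toRingHom hJ, Ideal.Quotient.factor hI, fun _ => rfl,
    fun _ => rfl, hsection, Function.LeftInverse.injective hsection⟩
end

section
/- Let k be a field of prime characteristic p and m = (m_1,...,m_n) an n-tuple of positive integers. Let k̄ be an algebraic closure of k, let the group of k-algebra automorphisms of k̄ act coordinatewise on the vanishing set 𝒱(𝔞_m) ⊆ k̄^n, and let S ⊆ 𝒱(𝔞_m) be a set containing exactly one representative of each orbit of this action. For x = (x_1,...,x_n) ∈ S let k(x) denote the subfield of k̄ generated over k by x_1,...,x_n. Then there is a ring isomorphism 𝒞_{m/k} ≅ ⊕_{x ∈ S} k(x)[Y_1,...,Y_n] / (Y_1^{p^{v_p(m_1)}}, ..., Y_n^{p^{v_p(m_n)}}); in particular 𝒞_{m/k} is isomorphic to a finite direct product of local rings. -/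
set_option synthInstance.maxHeartbeats 1000000
set_option maxHeartbeats 1000000

open MvPolynomial

theorem add_pow_prime_pow_of_natCast_eq_zero {R : Type*} [CommRing R] {p : ℕ} (hp : p.Prime)
    (h : (p : R) = 0) (a b : R) (N : ℕ) : (a + b) ^ p ^ N = a ^ p ^ N + b ^ p ^ N := by
  obtain ⟨c, hc⟩ := exists_add_pow_prime_pow_eq hp a b N
  rw [hc, h]
  ring

theorem pow_sub_pow_eq_zero_of_modEq {R : Type*} [CommRing R] {a : R} {q r Q : ℕ}
    (ha : a ^ (q * r) = 1) (hQ : Q ≡ 1 [MOD r]) : a ^ q - (a ^ Q) ^ q = 0 := by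
  rw [← pow_mul, mul_comm Q q, pow_mul, pow_eq_pow_mod Q (by rw [← pow_mul, ha] : (a ^ q) ^ r = 1),
    hQ, ← pow_eq_pow_mod 1 (by rw [← pow_mul, ha] : (a ^ q) ^ r = 1), pow_one, sub_self]

/-- In characteristic `p`, raising to a power `Q = p ^ N` with `Q ≡ 1 [MOD r i]` splits the
circulant ring into its `p`-part and its prime-to-`p` part `B`. -/
theorem nonempty_ringEquiv_circulant_truncated {σ k B : Type*} [CommRing k] [CommRing B] {p : ℕ}
    (hp : p.Prime) (hk : (p : k) = 0) (r e : σ → ℕ) (N : ℕ) (he : ∀ i, e i ≤ N)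
    (hr : ∀ i, p ^ N ≡ 1 [MOD r i]) (π : MvPolynomial σ k →+* B) (hπ : Function.Surjective π)
    (hker : RingHom.ker π =
      Ideal.span (Set.range fun i => (X i : MvPolynomial σ k) ^ r i - 1)) :
    Nonempty
      ((MvPolynomial σ k ⧸
          Ideal.span (Set.range fun i => (X i : MvPolynomial σ k) ^ (p ^ e i * r i) - 1)) ≃+*
        (MvPolynomial σ B ⧸
          Ideal.span (Set.range fun i => (X i : MvPolynomial σ B) ^ p ^ e i))) := by
  set I := Ideal.span (Set.range fun i => (X i : MvPolynomial σ k) ^ (p ^ e i * r i) - 1) with hI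
  set T := Ideal.span (Set.range fun i => (X i : MvPolynomial σ B) ^ p ^ e i) with hT
  have hpA : (p : MvPolynomial σ k ⧸ I) = 0 := by
    rw [← map_natCast ((Ideal.Quotient.mk I).comp C), hk, map_zero]
  have hpC : (p : MvPolynomial σ B ⧸ T) = 0 := by
    rw [← map_natCast ((Ideal.Quotient.mk T).comp (C.comp (π.comp C))), hk, map_zero]
  have hu (i : σ) : π (X i) ^ r i = 1 := by
    rw [← sub_eq_zero, ← map_pow, ← map_one π, ← map_sub, ← RingHom.mem_ker, hker]
    exact Ideal.subset_span ⟨i, rfl⟩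
  let x : σ → MvPolynomial σ k ⧸ I := fun i => Ideal.Quotient.mk I (X i)
  have hx (i : σ) : x i ^ (p ^ e i * r i) = 1 := by
    rw [← sub_eq_zero, ← map_pow, ← map_one (Ideal.Quotient.mk I), ← map_sub,
      Ideal.Quotient.eq_zero_iff_mem]
    exact Ideal.subset_span ⟨i, rfl⟩
  let y : σ → MvPolynomial σ B ⧸ T := fun i => Ideal.Quotient.mk T (X i)
  have hy (i : σ) : y i ^ p ^ e i = 0 := by
    rw [← map_pow, Ideal.Quotient.eq_zero_iff_mem]
    exact Ideal.subset_span ⟨i, rfl⟩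
  have hQy (i : σ) : y i ^ p ^ N = 0 :=
    pow_eq_zero_of_le (Nat.pow_le_pow_right hp.pos (he i)) (hy i)
  let U : σ → MvPolynomial σ B ⧸ T := fun i => Ideal.Quotient.mk T (C (π (X i)))
  have hU (i : σ) : U i ^ r i = 1 := by
    simp only [U, ← map_pow, hu, map_one]
  have hQU (i : σ) : U i ^ p ^ N = U i := by
    rw [pow_eq_pow_mod _ (hU i), hr i, ← pow_eq_pow_mod _ (hU i), pow_one]
  let F : (MvPolynomial σ k ⧸ I) →+* (MvPolynomial σ B ⧸ T) :=
    Ideal.Quotient.lift I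
      (eval₂Hom ((Ideal.Quotient.mk T).comp (C.comp (π.comp C))) fun i => U i + y i) (by
      intro a ha
      rw [← RingHom.mem_ker]
      revert a
      change I ≤ _
      rw [hI, Ideal.span_le]
      rintro _ ⟨i, rfl⟩
      simp only [SetLike.mem_coe, RingHom.mem_ker, map_sub, map_pow, map_one, eval₂Hom_X']
      rw [pow_mul, add_pow_prime_pow_of_natCast_eq_zero hp hpC, hy, add_zero, ← pow_mul,
        mul_comm, pow_mul, hU, one_pow, sub_self])
  have hg : RingHom.ker π ≤ RingHom.ker
      (eval₂Hom ((Ideal.Quotient.mk I).comp C) fun i => x i ^ p ^ N) := by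
    rw [hker, Ideal.span_le]
    rintro _ ⟨i, rfl⟩
    simp only [SetLike.mem_coe, RingHom.mem_ker, map_sub, map_pow, map_one, eval₂Hom_X']
    rw [← pow_mul, ← Nat.sub_add_cancel (he i), pow_add, mul_assoc, mul_comm, pow_mul, hx,
      one_pow, sub_self]
  let g : B →+* (MvPolynomial σ k ⧸ I) := RingHom.liftOfSurjective π hπ ⟨_, hg⟩
  have hgπ (a : MvPolynomial σ k) :
      g (π a) = eval₂Hom ((Ideal.Quotient.mk I).comp C) (fun i => x i ^ p ^ N) a :=
    RingHom.liftOfRightInverse_comp_apply _ _ _ ⟨_, hg⟩ a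
  let G : (MvPolynomial σ B ⧸ T) →+* (MvPolynomial σ k ⧸ I) :=
    Ideal.Quotient.lift T (eval₂Hom g fun i => x i - x i ^ p ^ N) (by
      intro a ha
      rw [← RingHom.mem_ker]
      revert a
      change T ≤ _
      rw [hT, Ideal.span_le]
      rintro _ ⟨i, rfl⟩
      simp only [SetLike.mem_coe, RingHom.mem_ker, map_pow, eval₂Hom_X']
      have h := add_pow_prime_pow_of_natCast_eq_zero hp hpA (x i - x i ^ p ^ N) (x i ^ p ^ N) (e i)
      rw [sub_add_cancel] at h
      rw [← pow_sub_pow_eq_zero_of_modEq (hx i) (hr i), h]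
      ring)
  have hFx (i : σ) : F (x i) = U i + y i := by simp [F, x]
  have hFC (c : k) : F (Ideal.Quotient.mk I (C c)) = Ideal.Quotient.mk T (C (π (C c))) := by
    simp [F]
  have hGC (a : MvPolynomial σ k) : G (Ideal.Quotient.mk T (C (π a))) =
      eval₂Hom ((Ideal.Quotient.mk I).comp C) (fun i => x i ^ p ^ N) a := by
    simp [G, hgπ]
  have hGU (i : σ) : G (U i) = x i ^ p ^ N := by simp [U, hGC]
  have hGy (i : σ) : G (y i) = x i - x i ^ p ^ N := by simp [G, y]
  have hFQ (i : σ) : F (x i) ^ p ^ N = U i := by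
    rw [hFx, add_pow_prime_pow_of_natCast_eq_zero hp hpC, hQy, hQU, add_zero]
  refine ⟨RingEquiv.ofRingHom F G ?_ ?_⟩
  · refine Ideal.Quotient.ringHom_ext (MvPolynomial.ringHom_ext' ?_ fun i => ?_)
    · rw [← RingHom.cancel_right hπ]
      refine MvPolynomial.ringHom_ext (fun c => ?_) fun i => ?_
      · change F (G (Ideal.Quotient.mk T (C (π (C c))))) = Ideal.Quotient.mk T (C (π (C c)))
        rw [hGC, eval₂Hom_C, RingHom.comp_apply, hFC]
      · change F (G (U i)) = U i
        rw [hGU, map_pow, hFQ]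
    · change F (G (y i)) = y i
      rw [hGy, map_sub, map_pow, hFQ, hFx, add_sub_cancel_left]
  · refine Ideal.Quotient.ringHom_ext (MvPolynomial.ringHom_ext (fun c => ?_) fun i => ?_)
    · change G (F (Ideal.Quotient.mk I (C c))) = Ideal.Quotient.mk I (C c)
      rw [hFC, hGC, eval₂Hom_C, RingHom.comp_apply]
    · change G (F (x i)) = x i
      rw [hFx, map_add, hGU, hGy, add_sub_cancel]


theorem mem_ideal_span_X_pow_iff {σ R : Type*} [CommSemiring R] (q : σ → ℕ)
    (f : MvPolynomial σ R) :
    f ∈ Ideal.span (Set.range fun i => (X i : MvPolynomial σ R) ^ q i) ↔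
      ∀ d : σ →₀ ℕ, (∀ i, d i < q i) → coeff d f = 0 := by
  have h : (Set.range fun i => (X i : MvPolynomial σ R) ^ q i) =
      (fun s => monomial s (1 : R)) '' Set.range fun i => Finsupp.single i (q i) := by
    rw [← Set.range_comp]
    simp only [X_pow_eq_monomial, Function.comp_def]
  rw [h, mem_ideal_span_monomial_image]
  simp only [mem_support_iff, Set.exists_range_iff, Finsupp.single_le_iff]
  exact forall_congr' fun d => by
    rw [← not_imp_not, not_not]
    simp only [not_exists, not_le]

/-- A finite family of ring homomorphisms `B → R s` inducing a bijection `B → ∏ s, R s` induces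
an isomorphism on truncated polynomial rings. -/
theorem nonempty_ringEquiv_pi_truncated {σ ι B : Type*} [CommRing B] [Finite ι] {R : ι → Type*}
    [∀ s, CommRing (R s)] (φ : ∀ s, B →+* R s) (hinj : ∀ b, (∀ s, φ s b = 0) → b = 0)
    (hsurj : ∀ y : ∀ s, R s, ∃ b, ∀ s, φ s b = y s) (q : σ → ℕ) :
    Nonempty
      ((MvPolynomial σ B ⧸ Ideal.span (Set.range fun i => (X i : MvPolynomial σ B) ^ q i)) ≃+*
        (∀ s, MvPolynomial σ (R s) ⧸
          Ideal.span (Set.range fun i => (X i : MvPolynomial σ (R s)) ^ q i))) := by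
  classical
  have := Fintype.ofFinite ι
  let Ψ : MvPolynomial σ B →+* ∀ s, MvPolynomial σ (R s) ⧸
      Ideal.span (Set.range fun i => (X i : MvPolynomial σ (R s)) ^ q i) :=
    RingHom.pi fun s => (Ideal.Quotient.mk _).comp (MvPolynomial.map (φ s))
  have hker : RingHom.ker Ψ =
      Ideal.span (Set.range fun i => (X i : MvPolynomial σ B) ^ q i) := by
    ext f
    have h0 : Ψ f = 0 ↔ ∀ s, ∀ d : σ →₀ ℕ, (∀ i, d i < q i) → φ s (coeff d f) = 0 := by
      rw [funext_iff]
      refine forall_congr' fun s => ?_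
      change Ideal.Quotient.mk _ (MvPolynomial.map (φ s) f) = 0 ↔ _
      simp only [Ideal.Quotient.eq_zero_iff_mem, mem_ideal_span_X_pow_iff, coeff_map]
    rw [RingHom.mem_ker, mem_ideal_span_X_pow_iff, h0]
    exact ⟨fun h d hd => hinj _ fun s => h s d hd, fun h s d hd => by rw [h d hd, map_zero]⟩
  have hΨ : Function.Surjective Ψ := by
    intro z
    choose w hw using fun s => Ideal.Quotient.mk_surjective (z s)
    choose b hb using fun d : σ →₀ ℕ => hsurj fun s => coeff d (w s)
    refine ⟨∑ d ∈ Finset.univ.biUnion fun s => (w s).support, monomial d (b d), ?_⟩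
    funext s
    change Ideal.Quotient.mk _ (MvPolynomial.map (φ s) _) = _
    rw [← hw s]
    congr 1
    ext d
    simp only [map_sum, map_monomial, hb, coeff_sum, coeff_monomial, Finset.sum_ite_eq',
      Finset.mem_biUnion, Finset.mem_univ, true_and, mem_support_iff]
    split_ifs with h
    · rfl
    · push Not at h
      exact (h s).symm
  exact ⟨(Ideal.quotEquivOfEq hker.symm).trans (RingHom.quotientKerEquivOfSurjective hΨ)⟩

theorem exists_forall_eq_of_ker_ne {A ι : Type*} [CommRing A] [Finite ι] {K : ι → Type*}
    [∀ s, CommRing (K s)] (hK : ∀ s, IsField (K s)) (φ : ∀ s, A →+* K s)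
    (hφ : ∀ s, Function.Surjective (φ s))
    (hne : ∀ s t, RingHom.ker (φ s) = RingHom.ker (φ t) → s = t) (y : ∀ s, K s) :
    ∃ a, ∀ s, φ s a = y s := by
  choose a ha using fun s => hφ s (y s)
  have hmax (s : ι) : (RingHom.ker (φ s)).IsMaximal := by
    let := (hK s).toField
    exact RingHom.ker_isMaximal_of_surjective (φ s) (hφ s)
  obtain ⟨b, hb⟩ := Ideal.exists_forall_sub_mem_ideal (I := fun s => RingHom.ker (φ s))
    (fun s t hst => Ideal.isCoprime_of_isMaximal fun h => hst (hne s t h)) a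
  refine ⟨b, fun s => ?_⟩
  have := hb s
  rwa [RingHom.mem_ker, map_sub, sub_eq_zero, ha] at this

theorem exists_degreeOf_lt_sub_mem {σ k : Type*} [Fintype σ] [CommRing k] (r : σ → ℕ)
    (hr : ∀ i, 0 < r i) (f : MvPolynomial σ k) :
    ∃ g : MvPolynomial σ k, (∀ i, g.degreeOf i < r i) ∧
      f - g ∈ Ideal.span (Set.range fun i => (X i : MvPolynomial σ k) ^ r i - 1) := by
  classical
  induction f using MvPolynomial.induction_on' with
  | monomial d c =>
    refine ⟨monomial (Finsupp.equivFunOnFinite.symm fun i => d i % r i) c, fun i => ?_, ?_⟩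
    · by_cases hc : c = 0
      · simpa [hc] using hr i
      · rw [degreeOf_monomial_eq _ _ hc]
        exact Nat.mod_lt _ (hr i)
    · rw [← Ideal.Quotient.eq, monomial_eq, monomial_eq, Finsupp.prod_fintype _ _ (by simp),
        Finsupp.prod_fintype _ _ (by simp), map_mul, map_mul, map_prod, map_prod]
      congr 1
      refine Finset.prod_congr rfl fun i _ => ?_
      rw [map_pow, map_pow, Finsupp.equivFunOnFinite_symm_apply_apply]
      refine pow_eq_pow_mod _ ?_
      rw [← map_pow, ← map_one (Ideal.Quotient.mk _), Ideal.Quotient.eq]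
      exact Ideal.subset_span ⟨i, rfl⟩
  | add f₁ f₂ h₁ h₂ =>
    obtain ⟨g₁, hd₁, hg₁⟩ := h₁
    obtain ⟨g₂, hd₂, hg₂⟩ := h₂
    refine ⟨g₁ + g₂, fun i => (degreeOf_add_le i g₁ g₂).trans_lt (max_lt (hd₁ i) (hd₂ i)), ?_⟩
    rw [add_sub_add_comm]
    exact add_mem hg₁ hg₂

theorem mem_span_X_pow_sub_one_of_aeval_eq_zero {σ k L : Type*} [Fintype σ] [Field k] [Field L]
    [Algebra k L] [IsAlgClosed L] (r : σ → ℕ) (hr : ∀ i, (r i : k) ≠ 0) (f : MvPolynomial σ k)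
    (hf : ∀ x : σ → L, (∀ i, x i ^ r i = 1) → aeval x f = 0) :
    f ∈ Ideal.span (Set.range fun i => (X i : MvPolynomial σ k) ^ r i - 1) := by
  have hr0 (i : σ) : 0 < r i := Nat.pos_of_ne_zero fun h => hr i (by rw [h, Nat.cast_zero])
  obtain ⟨g, hg, hfg⟩ := exists_degreeOf_lt_sub_mem r hr0 f
  suffices h : g = 0 by rwa [h, sub_zero] at hfg
  have hvan : Ideal.span (Set.range fun i => (X i : MvPolynomial σ k) ^ r i - 1) ≤
      ⨅ x : {x : σ → L // ∀ i, x i ^ r i = 1}, RingHom.ker (aeval (R := k) x.1) := by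
    rw [Ideal.span_le]
    rintro _ ⟨i, rfl⟩
    simp only [SetLike.mem_coe, Ideal.mem_iInf, RingHom.mem_ker]
    intro x
    simp [x.2 i]
  have hg0 (x : σ → L) (hx : ∀ i, x i ^ r i = 1) : aeval x g = 0 := by
    have := (Ideal.mem_iInf.mp (hvan hfg)) ⟨x, hx⟩
    rw [RingHom.mem_ker, map_sub, hf x hx, zero_sub, neg_eq_zero] at this
    exact this
  refine MvPolynomial.map_injective (algebraMap k L) (algebraMap k L).injective ?_
  rw [map_zero]
  refine eq_zero_of_eval_zero_at_prod_finset _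
    (fun i => Polynomial.nthRootsFinset (r i) (1 : L)) (fun i => ?_) fun x hx => ?_
  · have : NeZero (r i) := ⟨(hr0 i).ne'⟩
    have : NeZero (r i : L) := ⟨by
      rw [← map_natCast (algebraMap k L)]
      exact (map_ne_zero _).mpr (hr i)⟩
    obtain ⟨ζ, hζ⟩ := HasEnoughRootsOfUnity.exists_primitiveRoot L (r i)
    rw [hζ.card_nthRootsFinset, degreeOf_eq_sup,
      support_map_of_injective _ (algebraMap k L).injective, ← degreeOf_eq_sup]
    exact hg i
  · rw [eval_map, ← aeval_def]
    exact hg0 x fun i => (Polynomial.mem_nthRootsFinset (hr0 i) _).mp (hx i)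

theorem exists_algEquiv_of_ker_aeval_eq {σ k L : Type*} [Field k] [Field L] [Algebra k L]
    [IsAlgClosed L] [Algebra.IsAlgebraic k L] (s t : σ → L)
    (h : RingHom.ker (aeval (R := k) s) = RingHom.ker (aeval (R := k) t)) :
    ∃ τ : L ≃ₐ[k] L, ∀ i, τ (s i) = t i := by
  let π := (aeval (R := k) s).rangeRestrict
  let : Field (aeval (R := k) s).range := (Subalgebra.isField_of_algebraic _).toField
  have hπ : Function.Surjective π := (aeval (R := k) s).rangeRestrict_surjective
  have hker : RingHom.ker π = RingHom.ker (aeval (R := k) t) := by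
    rw [← h]
    ext a
    simp [π, RingHom.mem_ker, Subtype.ext_iff]
  let g : (MvPolynomial σ k ⧸ RingHom.ker π) →ₐ[k] L :=
    Ideal.Quotient.liftₐ (RingHom.ker π) (aeval t) fun a ha => by
      rwa [hker, RingHom.mem_ker] at ha
  let f : (aeval (R := k) s).range →ₐ[k] L :=
    g.comp (Ideal.quotientKerAlgEquivOfSurjective hπ).symm.toAlgHom
  have hf (i : σ) : f (π (X i)) = t i := by
    have : (Ideal.quotientKerAlgEquivOfSurjective hπ).symm (π (X i)) =
        Ideal.Quotient.mk _ (X i) := by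
      rw [AlgEquiv.symm_apply_eq]
      rfl
    change g ((Ideal.quotientKerAlgEquivOfSurjective hπ).symm (π (X i))) = t i
    rw [this]
    exact aeval_X t i
  have : Algebra.IsAlgebraic (aeval (R := k) s).range L := Algebra.IsAlgebraic.tower_top (K := k) _
  obtain ⟨τ, hτ⟩ := IsAlgClosed.surjective_domRestrict_of_isAlgebraic (K := k) (E := L) f
  refine ⟨(Algebra.IsAlgebraic.algEquivEquivAlgHom k L).symm τ, fun i => ?_⟩
  have := DFunLike.congr_fun hτ (π (X i))
  rw [hf] at this
  change τ (aeval s (X i)) = t i at this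
  rwa [aeval_X] at this

theorem forall_mem_span_X_pow_sub_one_aeval_eq_zero_iff {σ k L : Type*} [CommRing k] [CommRing L]
    [Algebra k L] (m : σ → ℕ) (x : σ → L) :
    (∀ f ∈ Ideal.span (Set.range fun i => (X i : MvPolynomial σ k) ^ m i - 1), aeval x f = 0) ↔
      ∀ i, x i ^ m i = 1 := by
  change _ ≤ RingHom.ker (aeval (R := k) x) ↔ _
  rw [Ideal.span_le, Set.range_subset_iff]
  refine forall_congr' fun i => ?_
  simp [RingHom.mem_ker, sub_eq_zero]

theorem exists_le_pow_modEq_one {σ : Type*} [Fintype σ] {p : ℕ} (r e : σ → ℕ)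
    (hr : ∀ i, 0 < r i) (hpr : ∀ i, p.Coprime (r i)) :
    ∃ N, (∀ i, e i ≤ N) ∧ ∀ i, p ^ N ≡ 1 [MOD r i] := by
  refine ⟨(∏ i, r i).totient * ∑ i, e i, fun i => ?_, fun i => ?_⟩
  · exact (Finset.single_le_sum (fun _ _ => Nat.zero_le _) (Finset.mem_univ i)).trans
      (Nat.le_mul_of_pos_left _ (Nat.totient_pos.mpr (Finset.prod_pos fun i _ => hr i)))
  · have h := (Nat.ModEq.pow_totient (Nat.Coprime.prod_right (t := Finset.univ)
      fun i _ => hpr i)).pow (∑ i, e i)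
    rw [← pow_mul, one_pow] at h
    exact h.of_dvd (Finset.dvd_prod_of_mem r (Finset.mem_univ i))

/-- local ring decomposition: over a field of prime characteristic `p`,
with `S` a set of representatives of the orbits of the coordinatewise action of the
`k`-algebra automorphisms of `k̄` on `𝒱(𝔞_m)`, there is a ring isomorphism
`𝒞_{m/k} ≅ ⊕_{x ∈ S} k(x)[Y₁,…,Yₙ]/(Y₁^{p^{v_p(m₁)}}, …, Yₙ^{p^{v_p(mₙ)}})`. -/
theorem stmt_16 {k : Type*} [Field k] {p : ℕ} (hp : p.Prime) [CharP k p]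
    {n : ℕ} (m : Fin n → ℕ) (hm : ∀ i, 0 < m i)
    (S : Set (Fin n → AlgebraicClosure k))
    (hSV : ∀ x ∈ S, ∀ f ∈ Ideal.span
        (Set.range fun i => (X i : MvPolynomial (Fin n) k) ^ m i - 1),
        MvPolynomial.aeval x f = 0)
    (hrep : ∀ x : Fin n → AlgebraicClosure k,
      (∀ f ∈ Ideal.span
          (Set.range fun i => (X i : MvPolynomial (Fin n) k) ^ m i - 1),
          MvPolynomial.aeval x f = 0) →
      ∃! s, s ∈ S ∧ ∃ σ : AlgebraicClosure k ≃ₐ[k] AlgebraicClosure k,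
        (fun i => σ (x i)) = s) :
    Nonempty
      ((MvPolynomial (Fin n) k ⧸
          Ideal.span (Set.range fun i => (X i : MvPolynomial (Fin n) k) ^ m i - 1)) ≃+*
        (∀ s : S,
          MvPolynomial (Fin n)
              (Algebra.adjoin k (Set.range (s : Fin n → AlgebraicClosure k))) ⧸
            Ideal.span (Set.range fun i =>
              (X i : MvPolynomial (Fin n)
                  (Algebra.adjoin k (Set.range (s : Fin n → AlgebraicClosure k)))) ^
                p ^ (m i).factorization p))) := by
  have : Fact p.Prime := ⟨hp⟩
  have : CharP (AlgebraicClosure k) p := charP_of_injective_algebraMap' k p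
  let e : Fin n → ℕ := fun i => (m i).factorization p
  let r : Fin n → ℕ := fun i => m i / p ^ e i
  have hmr (i : Fin n) : m i = p ^ e i * r i := (Nat.ordProj_mul_ordCompl_eq_self (m i) p).symm
  have hpr (i : Fin n) : p.Coprime (r i) := Nat.coprime_ordCompl hp (hm i).ne'
  have hr0 (i : Fin n) : 0 < r i := Nat.ordCompl_pos p (hm i).ne'
  have hrk (i : Fin n) : (r i : k) ≠ 0 := by
    rw [Ne, CharP.cast_eq_zero_iff k p]
    exact (Nat.Prime.coprime_iff_not_dvd hp).mp (hpr i)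
  have hmem (x : Fin n → AlgebraicClosure k) :
      (∀ f ∈ Ideal.span (Set.range fun i => (X i : MvPolynomial (Fin n) k) ^ m i - 1),
        MvPolynomial.aeval x f = 0) ↔ ∀ i, x i ^ r i = 1 := by
    rw [forall_mem_span_X_pow_sub_one_aeval_eq_zero_iff]
    refine forall_congr' fun i => ?_
    rw [hmr i, ExpChar.pow_prime_pow_mul_eq_one_iff]
  have hSr (s : S) (i : Fin n) : s.1 i ^ r i = 1 := (hmem s.1).mp (hSV s.1 s.2) i
  have : Finite S := by
    refine Set.Finite.to_subtype <| (Set.Finite.pi' fun i =>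
      (Polynomial.nthRootsFinset (r i) (1 : AlgebraicClosure k)).finite_toSet).subset ?_
    exact fun s hs i => (Polynomial.mem_nthRootsFinset (hr0 i) _).mpr (hSr ⟨s, hs⟩ i)
  let J := Ideal.span (Set.range fun i => (X i : MvPolynomial (Fin n) k) ^ r i - 1)
  let φ (s : S) : MvPolynomial (Fin n) k →ₐ[k] Algebra.adjoin k (Set.range s.1) :=
    (aeval s.1).codRestrict _ fun f => by
      rw [Algebra.adjoin_range_eq_range_aeval]
      exact ⟨f, rfl⟩
  have hφ (s : S) (f : MvPolynomial (Fin n) k) : (φ s f : AlgebraicClosure k) = aeval s.1 f := rfl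
  have hφsurj (s : S) : Function.Surjective (φ s) := by
    rintro ⟨y, hy⟩
    have hy' := hy
    rw [Algebra.adjoin_range_eq_range_aeval] at hy'
    obtain ⟨f, hf⟩ := hy'
    exact ⟨f, Subtype.ext hf⟩
  have hφker (s : S) : RingHom.ker (φ s) = RingHom.ker (aeval (R := k) s.1) := by
    ext f
    rw [RingHom.mem_ker, RingHom.mem_ker, ← hφ, ZeroMemClass.coe_eq_zero]
  have hφJ (s : S) : ∀ f ∈ J, φ s f = 0 := fun f hf => Subtype.ext <|
    (forall_mem_span_X_pow_sub_one_aeval_eq_zero_iff r s.1).mpr (hSr s) f hf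
  have hφinj (f : MvPolynomial (Fin n) k) (hf : ∀ s, φ s f = 0) : f ∈ J := by
    refine mem_span_X_pow_sub_one_of_aeval_eq_zero (L := AlgebraicClosure k) r hrk f fun x hx => ?_
    obtain ⟨s, ⟨hs, τ, hτ⟩, -⟩ := hrep x ((hmem x).mpr hx)
    have h0 : aeval s f = 0 := by rw [← hφ ⟨s, hs⟩, hf, ZeroMemClass.coe_zero]
    rw [← hτ] at h0
    change aeval (τ ∘ x) f = 0 at h0
    refine τ.injective ?_
    rw [map_zero, ← h0]
    exact (comp_aeval_apply x τ.toAlgHom f).symm ▸ rfl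
  have hne (s t : S) (h : RingHom.ker (φ s).toRingHom = RingHom.ker (φ t).toRingHom) : s = t := by
    obtain ⟨τ, hτ⟩ := exists_algEquiv_of_ker_aeval_eq s.1 t.1 (by
      rw [← hφker, ← hφker]
      exact h)
    exact Subtype.ext ((hrep s.1 (hSV s.1 s.2)).unique ⟨s.2, AlgEquiv.refl, rfl⟩
      ⟨t.2, τ, funext hτ⟩)
  obtain ⟨N, heN, hrN⟩ := exists_le_pow_modEq_one r e hr0 hpr
  obtain ⟨E₁⟩ := nonempty_ringEquiv_circulant_truncated hp (CharP.cast_eq_zero k p) r e N heN hrN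
    (Ideal.Quotient.mk J) Ideal.Quotient.mk_surjective Ideal.mk_ker
  obtain ⟨E₂⟩ := nonempty_ringEquiv_pi_truncated
    (fun s => Ideal.Quotient.lift J (φ s).toRingHom (hφJ s))
    (fun b hb => by
      obtain ⟨f, rfl⟩ := Ideal.Quotient.mk_surjective b
      exact Ideal.Quotient.eq_zero_iff_mem.mpr (hφinj f hb))
    (fun y => by
      obtain ⟨f, hf⟩ := exists_forall_eq_of_ker_ne
        (fun s : S => Subalgebra.isField_of_algebraic (Algebra.adjoin k (Set.range s.1)))
        (fun s => (φ s).toRingHom) hφsurj hne y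
      exact ⟨Ideal.Quotient.mk J f, hf⟩)
    fun i => p ^ e i
  exact ⟨((Ideal.quotEquivOfEq (by simp only [← hmr])).trans E₁).trans E₂⟩
end

section
/- Let k be a field whose characteristic p is either 0 or a prime, and let m = (m_1,...,m_n) be an n-tuple of positive integers. If some entry m_i is not a power of p (where for p = 0 this means m_i ≠ 1), then the circulant ring 𝒞_{m/k} is not a local ring. -/
open MvPolynomial

/-- A natural number that is not a power of `ringChar k` has a prime factor invertible in `k`. -/
lemma exists_prime_dvd_natCast_ne_zero (k : Type*) [Field k] {a : ℕ} (ha : 0 < a)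
    (h : ∀ e : ℕ, a ≠ ringChar k ^ e) : ∃ q : ℕ, q.Prime ∧ q ∣ a ∧ (q : k) ≠ 0 := by
  by_contra! H
  refine h _ (Nat.eq_prime_pow_of_unique_prime_dvd ha.ne' fun {d} hd hda => ?_)
  rcases (Nat.dvd_prime hd).1 (ringChar.dvd (H d hd hda)) with h1 | h1
  · have h2 : ((1 : ℕ) : k) = 0 := (ringChar.spec k 1).2 h1.dvd
    simp at h2
  · exact h1.symm

/-- If `q` is invertible in a local ring, then `x - 1` or `1 + x + ⋯ + x ^ (q - 1)` is. -/
lemma IsLocalRing.isUnit_sub_one_or_isUnit_geom_sum {R : Type*} [CommRing R] [IsLocalRing R]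
    {q : ℕ} (hq : IsUnit (q : R)) (x : R) :
    IsUnit (x - 1) ∨ IsUnit (∑ j ∈ Finset.range q, x ^ j) := by
  obtain ⟨t, ht⟩ : x - 1 ∣ ∑ j ∈ Finset.range q, (x ^ j - 1) :=
    Finset.dvd_sum fun j _ => by simpa using sub_dvd_pow_sub_pow x 1 j
  have hsum : (q : R) = (x - 1) * (-t) + ∑ j ∈ Finset.range q, x ^ j := by
    simp only [Finset.sum_sub_distrib, Finset.sum_const, Finset.card_range, nsmul_eq_mul,
      mul_one] at ht
    linear_combination -ht
  rw [hsum] at hq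
  exact (IsLocalRing.isUnit_or_isUnit_of_isUnit_add hq).imp_left isUnit_of_mul_isUnit_left

/-- The point of the spectrum of a circulant ring given by a tuple of roots of unity. -/
lemma exists_ringHom_circulant {k K : Type*} [Field k] [Field K] [Algebra k K] {n : ℕ}
    (m : Fin n → ℕ) (z : Fin n → K) (hz : ∀ i, z i ^ m i = 1) :
    ∃ f : (MvPolynomial (Fin n) k ⧸
        Ideal.span (Set.range fun i => (X i : MvPolynomial (Fin n) k) ^ m i - 1)) →+* K,
      ∀ i, f (Ideal.Quotient.mk _ (X i)) = z i := by
  refine ⟨Ideal.Quotient.lift _ (aeval z : MvPolynomial (Fin n) k →ₐ[k] K).toRingHom ?_,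
    fun i => by simp⟩
  intro a ha
  suffices H : Ideal.span (Set.range fun i => (X i : MvPolynomial (Fin n) k) ^ m i - 1) ≤
      RingHom.ker (aeval z : MvPolynomial (Fin n) k →ₐ[k] K).toRingHom from H ha
  rw [Ideal.span_le]
  rintro _ ⟨i, rfl⟩
  simp [RingHom.mem_ker, hz]

/-- if some entry `m_i` is not a power of the characteristic of `k`
(which is always `0` or a prime; for characteristic `0`, "not a power" amounts to
`m_i ≠ 1`), then the circulant ring `𝒞_{m/k}` is not local. -/
theorem stmt_17 {k : Type*} [Field k] {n : ℕ} (m : Fin n → ℕ) (hm : ∀ i, 0 < m i)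
    (h : ∃ i, ∀ e : ℕ, m i ≠ ringChar k ^ e) :
    ¬ IsLocalRing
        (MvPolynomial (Fin n) k ⧸
          Ideal.span (Set.range fun i => (X i : MvPolynomial (Fin n) k) ^ m i - 1)) := by
  intro hloc
  obtain ⟨i, hi⟩ := h
  obtain ⟨q, hq, hqm, hqk⟩ := exists_prime_dvd_natCast_ne_zero k (hm i) hi
  have : Fact q.Prime := ⟨hq⟩
  obtain ⟨ζ, hζ⟩ := IsAlgClosed.exists_root (Polynomial.cyclotomic q (AlgebraicClosure k))
    (Polynomial.degree_cyclotomic_pos q _ hq.pos).ne'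
  have hsum : ∑ j ∈ Finset.range q, ζ ^ j = 0 := by
    simpa [Polynomial.cyclotomic_prime, Polynomial.eval_finsetSum] using hζ
  have hζm : ζ ^ m i = 1 := by
    obtain ⟨c, hc⟩ := hqm
    have hζq : ζ ^ q = 1 := by
      have := geom_sum_mul ζ q
      rw [hsum, zero_mul] at this
      exact sub_eq_zero.1 this.symm
    rw [hc, pow_mul, hζq, one_pow]
  obtain ⟨f, hf⟩ := exists_ringHom_circulant (k := k) (K := k) m 1 (by simp)
  obtain ⟨g, hg⟩ := exists_ringHom_circulant (k := k) m
    (Function.update (1 : Fin n → AlgebraicClosure k) i ζ) (fun j => by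
      rcases eq_or_ne j i with rfl | hj <;> simp [*])
  have hqR : IsUnit (q : MvPolynomial (Fin n) k ⧸
      Ideal.span (Set.range fun i => (X i : MvPolynomial (Fin n) k) ^ m i - 1)) := by
    simpa using (IsUnit.mk0 _ hqk).map (algebraMap k (MvPolynomial (Fin n) k ⧸
      Ideal.span (Set.range fun i => (X i : MvPolynomial (Fin n) k) ^ m i - 1)))
  rcases IsLocalRing.isUnit_sub_one_or_isUnit_geom_sum hqR (Ideal.Quotient.mk _ (X i)) with hu | hu
  · apply (hu.map f).ne_zero
    rw [map_sub, hf, map_one, Pi.one_apply, sub_self]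
  · apply (hu.map g).ne_zero
    simp only [map_sum, map_pow, hg, Function.update_self, hsum]
end

section
/- Let 𝔽_q be a finite field of characteristic p with q elements and m = (m_1,...,m_n) an n-tuple of positive integers. For each n-tuple d = (d_1,...,d_n) with d_i a positive divisor of r_p(m_i) for every i, set ν(d) := lcm_{1 ≤ i ≤ n} ord_{d_i}(q) (the least common multiple of the multiplicative orders of q modulo the d_i) and η(d) := (∏_{i=1}^n φ(d_i)) / ν(d), where φ is Euler's totient function. Then there is a ring isomorphism 𝒞_{m/𝔽_q} ≅ ⊕_d ( 𝔽_{q^{ν(d)}}[Y_1,...,Y_n] / (Y_1^{p^{v_p(m_1)}} − 1, ..., Y_n^{p^{v_p(m_n)}} − 1) )^{η(d)}, where d ranges over all n-tuples of positive divisors d_i | r_p(m_i), and 𝔽_{q^{ν(d)}} denotes the finite field with q^{ν(d)} elements. -/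
set_option synthInstance.maxHeartbeats 1000000
set_option maxHeartbeats 1000000

open MvPolynomial

/-- The circulant ring `R[X₁, …, Xₙ] / (X₁ ^ e₁ - 1, …, Xₙ ^ eₙ - 1)`. -/
abbrev CirculantRing (R : Type*) [CommRing R] {ι : Type*} (e : ι → ℕ) : Type _ :=
  MvPolynomial ι R ⧸ Ideal.span (Set.range fun i => (X i : MvPolynomial ι R) ^ e i - 1)

namespace CirculantRing

section Basic

variable {R : Type*} [CommRing R] {ι : Type*} {e : ι → ℕ}

/-- The class of the `i`-th variable. -/
noncomputable def root (R : Type*) [CommRing R] {ι : Type*} (e : ι → ℕ) (i : ι) :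
    CirculantRing R e :=
  Ideal.Quotient.mk _ (X i)

lemma root_pow (i : ι) : root R e i ^ e i = 1 := by
  rw [← sub_eq_zero, root, ← map_pow, ← map_one (Ideal.Quotient.mk _), ← map_sub,
    Ideal.Quotient.eq_zero_iff_mem]
  exact Ideal.subset_span ⟨i, rfl⟩

/-- The algebra homomorphism sending the `i`-th variable to `z i`. -/
noncomputable def lift {S : Type*} [CommRing S] [Algebra R S] (z : ι → S)
    (hz : ∀ i, z i ^ e i = 1) : CirculantRing R e →ₐ[R] S :=
  Ideal.Quotient.liftₐ _ (aeval z) (by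
    intro a ha
    have : Ideal.span (Set.range fun i => (X i : MvPolynomial ι R) ^ e i - 1) ≤
        RingHom.ker (aeval z : MvPolynomial ι R →ₐ[R] S) := by
      rw [Ideal.span_le]
      rintro _ ⟨i, rfl⟩
      simp [RingHom.mem_ker, hz]
    exact this ha)

@[simp] lemma lift_root {S : Type*} [CommRing S] [Algebra R S] (z : ι → S)
    (hz : ∀ i, z i ^ e i = 1) (i : ι) : lift (R := R) z hz (root R e i) = z i :=
  (Ideal.Quotient.lift_mk _ _ _).trans (aeval_X z i)

lemma algHom_ext {S : Type*} [CommRing S] [Algebra R S] {f g : CirculantRing R e →ₐ[R] S}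
    (h : ∀ i, f (root R e i) = g (root R e i)) : f = g := by
  apply Ideal.Quotient.algHom_ext
  ext i
  exact h i

variable [Fintype ι] [DecidableEq ι] [∀ i, NeZero (e i)]

/-- The monomial in the classes of the variables with exponents in `ZMod (e i)`. -/
noncomputable def monomialHom (R : Type*) [CommRing R] (e : ι → ℕ) [∀ i, NeZero (e i)] :
    Multiplicative (∀ i, ZMod (e i)) →* CirculantRing R e where
  toFun a := ∏ i, root R e i ^ (a.toAdd i).val
  map_one' := by simp
  map_mul' a b := by
    rw [← Finset.prod_mul_distrib]
    refine Finset.prod_congr rfl fun i _ => ?_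
    rw [toAdd_mul, Pi.add_apply, ZMod.val_add, ← pow_eq_pow_mod _ (root_pow i), pow_add]

/-- A circulant ring is the group algebra of a product of cyclic groups. -/
noncomputable def equivAddMonoidAlgebra (R : Type*) [CommRing R] (e : ι → ℕ)
    [∀ i, NeZero (e i)] :
    CirculantRing R e ≃ₐ[R] AddMonoidAlgebra R (∀ i, ZMod (e i)) :=
  AlgEquiv.ofAlgHom
    (lift (fun i => AddMonoidAlgebra.single (Pi.single i 1) 1) (by
      intro i
      rw [AddMonoidAlgebra.single_pow, one_pow, ← Pi.single_smul]
      simp [AddMonoidAlgebra.one_def]))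
    (AddMonoidAlgebra.lift R _ _ (monomialHom R e))
    (by
      refine AddMonoidAlgebra.algHom_ext (fun a => ?_) (AlgHom.ext fun x => ?_)
      swap
      · exact (AlgHom.commutes _ x)
      simp only [AlgHom.comp_apply, AddMonoidAlgebra.lift_single, one_smul, AlgHom.id_apply]
      simp only [monomialHom, MonoidHom.coe_mk, OneHom.coe_mk, map_prod, map_pow, lift_root,
        AddMonoidAlgebra.single_pow, one_pow, toAdd_ofAdd]
      have h : ∀ b : ∀ i, ZMod (e i), (AddMonoidAlgebra.single b 1 : AddMonoidAlgebra R _) =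
          AddMonoidAlgebra.of R _ (Multiplicative.ofAdd b) := fun _ => rfl
      simp only [h, ← map_prod, ← ofAdd_sum]
      congr 2
      conv_rhs => rw [← Finset.univ_sum_single a]
      refine Finset.sum_congr rfl fun i _ => ?_
      rw [← Pi.single_smul]
      simp)
    (by
      refine algHom_ext fun i => ?_
      simp only [AlgHom.comp_apply, lift_root, AddMonoidAlgebra.lift_single, one_smul,
        AlgHom.id_apply]
      simp only [monomialHom, MonoidHom.coe_mk, OneHom.coe_mk, toAdd_ofAdd]
      rw [Finset.prod_eq_single i]
      · rw [Pi.single_eq_same, ZMod.val_one_eq_one_mod, ← pow_eq_pow_mod _ (root_pow i), pow_one]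
      · intro j _ hj
        simp [Pi.single_eq_of_ne hj]
      · simp)

end Basic

/-- Group algebras of finite groups commute with products of coefficient rings. -/
noncomputable def _root_.AddMonoidAlgebra.piRingEquiv {κ : Type*} (S : κ → Type*)
    [∀ j, CommRing (S j)] (G : Type*) [AddCommGroup G] [Finite G] :
    AddMonoidAlgebra (∀ j, S j) G ≃+* ∀ j, AddMonoidAlgebra (S j) G :=
  RingEquiv.ofBijective
    (RingHom.pi fun j => AddMonoidAlgebra.mapRingHom G (Pi.evalRingHom S j))
    (by
      constructor
      · intro a b h
        ext g j
        simpa using congrArg (fun a => a.coeff g) (congrFun h j)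
      · intro b
        refine ⟨⟨Finsupp.equivFunOnFinite.symm fun g j => (b j).coeff g⟩, ?_⟩
        funext j
        ext g
        simp)

lemma finrank_eq_lcm_orderOf {k L : Type*} [Field k] [Fintype k] [Field L] [Algebra k L]
    [Finite L] {ι : Type*} [Fintype ι] {z : ι → L} (hz : Algebra.adjoin k (Set.range z) = ⊤)
    (h0 : ∀ i, z i ≠ 0) :
    Module.finrank k L =
      Finset.univ.lcm fun i => orderOf ((Fintype.card k : ℕ) : ZMod (orderOf (z i))) := by
  apply Nat.dvd_left_injective
  funext j
  rw [← FiniteField.orderOf_frobeniusAlgHom]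
  simp only [Finset.lcm_dvd_iff, Finset.mem_univ, true_imp_iff, orderOf_dvd_iff_pow_eq_one,
    eq_iff_iff]
  have key : ∀ i, z i ^ Fintype.card k ^ j = z i ↔
      ((Fintype.card k : ℕ) : ZMod (orderOf (z i))) ^ j = 1 := by
    intro i
    have hfin : IsOfFinOrder (z i) := isOfFinOrder_iff_isUnit.mpr (isUnit_iff_ne_zero.mpr (h0 i))
    conv_lhs => rhs; rw [← pow_one (z i)]
    rw [hfin.pow_eq_pow_iff_modEq, ← ZMod.natCast_eq_natCast_iff]
    push_cast
    rfl
  have frob : ∀ x : L, (FiniteField.frobeniusAlgHom k L ^ j) x = x ^ Fintype.card k ^ j := by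
    intro x
    rw [AlgHom.coe_pow, FiniteField.coe_frobeniusAlgHom, pow_iterate]
  constructor
  · intro h i
    rw [← key, ← frob, h, AlgHom.one_apply]
  · intro h
    refine AlgHom.ext_of_adjoin_eq_top hz ?_
    rintro _ ⟨i, rfl⟩
    rw [frob, AlgHom.one_apply, key]
    exact h i

section Splitting

variable {k : Type*} [Field k] {ι : Type*} {r : ι → ℕ}

/-- The orders of the classes of the variables in the residue field at a maximal ideal. -/
noncomputable def orders (M : MaximalSpectrum (CirculantRing k r)) (i : ι) : ℕ :=
  orderOf (Ideal.Quotient.mk M.asIdeal (root k r i))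

lemma orders_dvd (M : MaximalSpectrum (CirculantRing k r)) (i : ι) : orders M i ∣ r i := by
  rw [orders, orderOf_dvd_iff_pow_eq_one, ← map_pow, root_pow, map_one]

variable [∀ i, NeZero (r i)]

lemma orders_pos (M : MaximalSpectrum (CirculantRing k r)) (i : ι) : 0 < orders M i :=
  Nat.pos_of_dvd_of_pos (orders_dvd M i) (NeZero.pos _)

variable [Fintype ι]

lemma isReduced (hr : ∀ i, (r i : k) ≠ 0) : IsReduced (CirculantRing k r) := by
  classical
  have : NeZero (Nat.card (∀ i, ZMod (r i)) : k) := ⟨by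
    rw [Nat.card_pi, Nat.cast_prod, Finset.prod_ne_zero_iff]
    intro i _
    simpa using hr i⟩
  exact isReduced_of_injective (equivAddMonoidAlgebra k r) (equivAddMonoidAlgebra k r).injective

variable [Fintype k]

instance : Finite (CirculantRing k r) := by
  classical
  have : Finite (AddMonoidAlgebra k (∀ i, ZMod (r i))) :=
    Finite.of_injective (β := (∀ i, ZMod (r i)) → k) (fun a g => a.coeff g) (by
      intro a b h
      ext g
      exact congrFun h g)
  exact Finite.of_equiv _ (equivAddMonoidAlgebra k r).symm.toEquiv

/-- The algebra homomorphisms from a circulant ring to a domain sending each variable to an element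
of the prescribed order. -/
noncomputable def algHomEquivPrimitiveRoots (K : Type*) [Field K] [Algebra k K] (d : ι → ℕ)
    (hd : ∀ i, 0 < d i ∧ d i ∣ r i) :
    {f : CirculantRing k r →ₐ[k] K // ∀ i, orderOf (f (root k r i)) = d i} ≃
      ∀ i, primitiveRoots (d i) K where
  toFun f i := ⟨f.1 (root k r i),
    (mem_primitiveRoots (hd i).1).2 (f.2 i ▸ IsPrimitiveRoot.orderOf _)⟩
  invFun z := ⟨lift (fun i => (z i : K)) (fun i =>
      ((mem_primitiveRoots (hd i).1).1 (z i).2).pow_eq_one_iff_dvd _ |>.2 (hd i).2), fun i => by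
    rw [lift_root]; exact ((mem_primitiveRoots (hd i).1).1 (z i).2).eq_orderOf.symm⟩
  left_inv f := Subtype.ext (algHom_ext fun i => by simp)
  right_inv z := by ext i; simp

lemma adjoin_range_root {R : Type*} [CommRing R] {ι : Type*} (e : ι → ℕ) :
    Algebra.adjoin R (Set.range (root R e)) = ⊤ := by
  have h := MvPolynomial.adjoin_range_X (R := R) (σ := ι)
  have h2 := congrArg (Subalgebra.map (Ideal.Quotient.mkₐ R
    (Ideal.span (Set.range fun i => (X i : MvPolynomial ι R) ^ e i - 1)))) h
  rw [AlgHom.map_adjoin, Algebra.map_top, (AlgHom.range_eq_top _).2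
    (Ideal.Quotient.mkₐ_surjective _ _), ← Set.range_comp] at h2
  exact h2

lemma finrank_quotient (M : MaximalSpectrum (CirculantRing k r)) :
    Module.finrank k (CirculantRing k r ⧸ M.asIdeal) =
      Finset.univ.lcm fun i => orderOf ((Fintype.card k : ℕ) : ZMod (orders M i)) := by
  have := M.isMaximal
  let _ := Ideal.Quotient.field M.asIdeal
  have : Finite (CirculantRing k r ⧸ M.asIdeal) :=
    Finite.of_surjective _ Ideal.Quotient.mk_surjective
  refine finrank_eq_lcm_orderOf (z := fun i => Ideal.Quotient.mk M.asIdeal (root k r i)) ?_ ?_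
  · have h2 := congrArg (Subalgebra.map (Ideal.Quotient.mkₐ k M.asIdeal))
      (adjoin_range_root (R := k) r)
    rw [AlgHom.map_adjoin, Algebra.map_top, (AlgHom.range_eq_top _).2
      (Ideal.Quotient.mkₐ_surjective _ _), ← Set.range_comp] at h2
    exact h2
  · intro i h
    have h1 : Ideal.Quotient.mk M.asIdeal (root k r i) ^ r i = 1 := by
      rw [← map_pow, root_pow, map_one]
    rw [h, zero_pow (NeZero.ne _)] at h1
    exact zero_ne_one h1

lemma bijective_sigma_comp_mk (K : Type*) [Field K] [Algebra k K] (d : ι → ℕ) :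
    Function.Bijective
      (fun x : (Σ M : {M : MaximalSpectrum (CirculantRing k r) // orders M = d},
          (CirculantRing k r ⧸ M.1.asIdeal →ₐ[k] K)) =>
        (⟨x.2.comp (Ideal.Quotient.mkₐ k x.1.1.asIdeal), fun i => by
          have := x.1.1.isMaximal
          let _ := Ideal.Quotient.field x.1.1.asIdeal
          exact (orderOf_injective (x.2 : _ →* K) x.2.toRingHom.injective _).trans
            (congrFun x.1.2 i)⟩ :
        {f : CirculantRing k r →ₐ[k] K // ∀ i, orderOf (f (root k r i)) = d i})) := by
  constructor
  · rintro ⟨⟨M, hM⟩, f⟩ ⟨⟨N, hN⟩, g⟩ h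
    have hfg : f.comp (Ideal.Quotient.mkₐ k M.asIdeal) = g.comp (Ideal.Quotient.mkₐ k N.asIdeal) :=
      congrArg Subtype.val h
    have ker : ∀ (M : MaximalSpectrum (CirculantRing k r))
        (f : CirculantRing k r ⧸ M.asIdeal →ₐ[k] K),
        RingHom.ker (f.comp (Ideal.Quotient.mkₐ k M.asIdeal)) = M.asIdeal := by
      intro M f
      have := M.isMaximal
      let _ := Ideal.Quotient.field M.asIdeal
      ext x
      rw [RingHom.mem_ker, AlgHom.comp_apply, Ideal.Quotient.mkₐ_eq_mk,
        ← Ideal.Quotient.eq_zero_iff_mem]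
      exact map_eq_zero_iff f f.toRingHom.injective
    have hMN : M = N := by
      ext1
      rw [← ker M f, ← ker N g, hfg]
    subst hMN
    obtain rfl : f = g := by
      apply Ideal.Quotient.algHom_ext
      exact hfg
    rfl
  · rintro ⟨f, hf⟩
    have hprime : (RingHom.ker f).IsPrime := RingHom.ker_isPrime f
    have hmax : (RingHom.ker f).IsMaximal := Ideal.IsPrime.isMaximal' hprime
    refine ⟨⟨⟨⟨RingHom.ker f, hmax⟩, ?_⟩, Ideal.kerLiftAlg f⟩, ?_⟩
    · funext i
      rw [← hf i, orders]
      exact (orderOf_injective (Ideal.kerLiftAlg f).toRingHom.toMonoidHom (Ideal.kerLiftAlg_injective f) _).symm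
    · apply Subtype.ext
      ext
      rfl

lemma card_orders_eq (hr : ∀ i, (r i : k) ≠ 0) (d : ι → ℕ) (hd : ∀ i, 0 < d i ∧ d i ∣ r i) :
    Nat.card {M : MaximalSpectrum (CirculantRing k r) // orders M = d} =
      (∏ i, (d i).totient) /
        Finset.univ.lcm fun i => orderOf ((Fintype.card k : ℕ) : ZMod (d i)) := by
  classical
  set ν := Finset.univ.lcm fun i => orderOf ((Fintype.card k : ℕ) : ZMod (d i)) with hν
  let K := AlgebraicClosure k
  have h1 := Nat.card_congr ((Equiv.ofBijective _
    (bijective_sigma_comp_mk (k := k) (r := r) K d)).trans (algHomEquivPrimitiveRoots K d hd))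
  have hfib : ∀ M : {M : MaximalSpectrum (CirculantRing k r) // orders M = d},
      Nat.card (CirculantRing k r ⧸ M.1.asIdeal →ₐ[k] K) = ν := by
    rintro ⟨M, hM⟩
    have := M.isMaximal
    let _ := Ideal.Quotient.field M.asIdeal
    rw [AlgHom.natCard_of_splits _ _ _ (fun _ => IsAlgClosed.splits _), finrank_quotient, hν, hM]
  have hroots : ∀ i, Nat.card (primitiveRoots (d i) K) = (d i).totient := by
    intro i
    have : NeZero (d i : K) := ⟨by
      have : (d i : k) ≠ 0 := fun h => hr i (by
        obtain ⟨c, hc⟩ := (hd i).2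
        rw [hc, Nat.cast_mul, h, zero_mul])
      simpa using (map_ne_zero (algebraMap k K)).2 this⟩
    have : NeZero (d i) := ⟨(hd i).1.ne'⟩
    obtain ⟨ζ, hζ⟩ := HasEnoughRootsOfUnity.exists_primitiveRoot K (d i)
    simp [hζ.card_primitiveRoots]
  have hpos : 0 < ν := by
    refine Nat.pos_of_ne_zero fun h => ?_
    obtain ⟨i, -, hi⟩ := Finset.lcm_eq_zero_iff.1 h
    have : NeZero (d i) := ⟨(hd i).1.ne'⟩
    have hcop : (Fintype.card k).Coprime (d i) := by
      obtain ⟨p, _⟩ := CharP.exists k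
      obtain ⟨a, hp, ha⟩ := FiniteField.card k p
      rw [ha]
      refine Nat.Coprime.pow_left _ ((Nat.Prime.coprime_iff_not_dvd hp).2 fun hpd => ?_)
      exact hr i ((CharP.cast_eq_zero_iff k p _).2 (hpd.trans (hd i).2))
    exact (orderOf_pos_iff.2 (isOfFinOrder_iff_isUnit.2
      ((ZMod.isUnit_iff_coprime _ _).2 hcop))).ne' hi
  have := Fintype.ofFinite {M : MaximalSpectrum (CirculantRing k r) // orders M = d}
  rw [Nat.card_sigma, Nat.card_pi] at h1
  simp only [hfib, hroots, Finset.sum_const, smul_eq_mul, Finset.card_univ] at h1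
  rw [← h1, Nat.mul_div_cancel _ hpos, Nat.card_eq_fintype_card]

/-- A separable circulant ring over a finite field is a product of finite fields. -/
lemma nonempty_ringEquiv_pi (hr : ∀ i, (r i : k) ≠ 0)
    (F : (∀ i, {d : ℕ // 0 < d ∧ d ∣ r i}) → Type*) [∀ d, Field (F d)] [∀ d, Fintype (F d)]
    (hF : ∀ d, Fintype.card (F d) = Fintype.card k ^
      (Finset.univ.lcm fun i => orderOf ((Fintype.card k : ℕ) : ZMod (d i).1))) :
    Nonempty (CirculantRing k r ≃+* ∀ d : ∀ i, {d : ℕ // 0 < d ∧ d ∣ r i},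
      Fin ((∏ i, Nat.totient (d i).1) /
        Finset.univ.lcm fun i => orderOf ((Fintype.card k : ℕ) : ZMod (d i).1)) → F d) := by
  have hred := isReduced (k := k) (r := r) hr
  let ty : MaximalSpectrum (CirculantRing k r) → ∀ i, {d : ℕ // 0 < d ∧ d ∣ r i} :=
    fun M i => ⟨orders M i, orders_pos M i, orders_dvd M i⟩
  have hty : ∀ M d, ty M = d ↔ orders M = fun i => (d i).1 := by
    intro M d
    simp only [funext_iff, Subtype.ext_iff, ty]
  have hfib : ∀ d : ∀ i, {d : ℕ // 0 < d ∧ d ∣ r i}, Nonempty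
      (Fin ((∏ i, Nat.totient (d i).1) /
        Finset.univ.lcm fun i => orderOf ((Fintype.card k : ℕ) : ZMod (d i).1)) ≃
        {M : MaximalSpectrum (CirculantRing k r) // ty M = d}) := by
    intro d
    refine ⟨(Finite.equivFinOfCardEq ?_).symm⟩
    simp only [hty]
    exact card_orders_eq hr _ fun i => (d i).2
  let fib := fun d => (hfib d).some
  let e := (Equiv.sigmaCongrRight fib).trans (Equiv.sigmaFiberEquiv ty)
  have hres : ∀ s, Nonempty (CirculantRing k r ⧸ (e s).asIdeal ≃+* F s.1) := by
    intro s
    have := (e s).isMaximal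
    let _ := Ideal.Quotient.field (e s).asIdeal
    have : Finite (CirculantRing k r ⧸ (e s).asIdeal) :=
      Finite.of_surjective _ Ideal.Quotient.mk_surjective
    let _ := Fintype.ofFinite (CirculantRing k r ⧸ (e s).asIdeal)
    refine ⟨FiniteField.ringEquivOfCardEq ?_⟩
    have hs : orders (e s) = fun i => (s.1 i).1 := (hty _ _).1 (fib s.1 s.2).2
    rw [hF, Module.card_eq_pow_finrank (K := k), finrank_quotient, hs]
  let res := fun s => (hres s).some
  let curry : (∀ s, F (Sigma.fst s)) ≃+* ∀ d : ∀ i, {d : ℕ // 0 < d ∧ d ∣ r i},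
      Fin ((∏ i, Nat.totient (d i).1) /
        Finset.univ.lcm fun i => orderOf ((Fintype.card k : ℕ) : ZMod (d i).1)) → F d :=
    { Equiv.piCurry fun d _ => F d with
      map_mul' := fun _ _ => rfl
      map_add' := fun _ _ => rfl }
  exact ⟨(IsArtinianRing.equivPi (CirculantRing k r)).toRingEquiv.trans <|
    (RingEquiv.piCongrLeft' _ e.symm).trans <| (RingEquiv.piCongrRight res).trans curry⟩

end Splitting

/-- If `m = e * r` with `e` and `r` coprime, the circulant ring of `m` is a group algebra over the
circulant ring of `r`. -/
lemma nonempty_ringEquiv_of_coprime_mul (k : Type*) [CommRing k] {ι : Type*} [Fintype ι]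
    {m r e : ι → ℕ} [∀ i, NeZero (m i)] [∀ i, NeZero (r i)] [∀ i, NeZero (e i)]
    (hm : ∀ i, m i = e i * r i) (hc : ∀ i, (e i).Coprime (r i)) :
    Nonempty (CirculantRing k m ≃+*
      AddMonoidAlgebra (CirculantRing k r) (∀ i, ZMod (e i))) := by
  classical
  let E : (∀ i, ZMod (m i)) ≃+ (∀ i, ZMod (e i)) × (∀ i, ZMod (r i)) :=
    (AddEquiv.piCongrRight fun i => ((ZMod.ringEquivCongr (hm i)).trans
      (ZMod.chineseRemainder (hc i))).toAddEquiv).trans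
    { Equiv.arrowProdEquivProdArrow _ (fun i => ZMod (e i)) (fun i => ZMod (r i)) with
      map_add' := fun _ _ => rfl }
  exact ⟨(equivAddMonoidAlgebra k m).toRingEquiv.trans <|
    (AddMonoidAlgebra.domCongr k k E).toRingEquiv.trans <|
    AddMonoidAlgebra.curryRingEquiv.trans <|
    AddMonoidAlgebra.mapRingEquiv _ (equivAddMonoidAlgebra k r).symm.toRingEquiv⟩

end CirculantRing

/-- Krull–Remak–Schmidt over finite fields: for a finite field `𝔽_q` of
characteristic `p`, the circulant ring `𝒞_{m/𝔽_q}` is isomorphic to the direct sum over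
all tuples `d` of positive divisors `d_i ∣ r_p(m_i)` of `η(d)` copies of
`𝔽_{q^{ν(d)}}[Y₁,…,Yₙ]/(Y₁^{p^{v_p(m₁)}} − 1, …, Yₙ^{p^{v_p(mₙ)}} − 1)`, where
`ν(d) = lcm_i ord_{d_i}(q)` and `η(d) = (∏ i, φ(d_i)) / ν(d)`.  Here the field
`𝔽_{q^{ν(d)}}` is represented by an arbitrary field `F d` of cardinality `q^{ν(d)}`. -/
theorem stmt_18 {p q : ℕ} (hp : p.Prime) {k : Type*} [Field k] [Fintype k]
    (hq : Fintype.card k = q) [CharP k p]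
    {n : ℕ} (m : Fin n → ℕ) (hm : ∀ i, 0 < m i)
    (F : (∀ i : Fin n, {d : ℕ // 0 < d ∧ d ∣ m i / p ^ (m i).factorization p}) → Type*)
    [∀ d, Field (F d)] [∀ d, Fintype (F d)]
    (hF : ∀ d, Fintype.card (F d) =
      q ^ (Finset.univ.lcm fun i => orderOf ((q : ZMod (d i).1)))) :
    Nonempty
      ((MvPolynomial (Fin n) k ⧸
          Ideal.span (Set.range fun i => (X i : MvPolynomial (Fin n) k) ^ m i - 1)) ≃+*
        (∀ d : ∀ i : Fin n, {d : ℕ // 0 < d ∧ d ∣ m i / p ^ (m i).factorization p},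
          Fin ((∏ i, Nat.totient (d i).1) /
              Finset.univ.lcm fun i => orderOf ((q : ZMod (d i).1))) →
            MvPolynomial (Fin n) (F d) ⧸
              Ideal.span (Set.range fun i =>
                (X i : MvPolynomial (Fin n) (F d)) ^ p ^ (m i).factorization p - 1))) := by
  subst hq
  have : ∀ i, NeZero (m i) := fun i => ⟨(hm i).ne'⟩
  have : ∀ i, NeZero (p ^ (m i).factorization p) := fun i => ⟨(pow_pos hp.pos _).ne'⟩
  have : ∀ i, NeZero (m i / p ^ (m i).factorization p) :=
    fun i => ⟨(Nat.ordCompl_pos p (hm i).ne').ne'⟩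
  obtain ⟨e₁⟩ := CirculantRing.nonempty_ringEquiv_of_coprime_mul k (m := m)
    (r := fun i => m i / p ^ (m i).factorization p) (e := fun i => p ^ (m i).factorization p)
    (fun i => (Nat.ordProj_mul_ordCompl_eq_self (m i) p).symm)
    (fun i => (Nat.coprime_ordCompl hp (hm i).ne').pow_left _)
  obtain ⟨e₂⟩ := CirculantRing.nonempty_ringEquiv_pi (k := k)
    (r := fun i => m i / p ^ (m i).factorization p)
    (fun i h => Nat.not_dvd_ordCompl hp (hm i).ne' ((CharP.cast_eq_zero_iff k p _).1 h)) F hF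
  exact ⟨e₁.trans <| (AddMonoidAlgebra.mapRingEquiv _ e₂).trans <|
    (AddMonoidAlgebra.piRingEquiv _ _).trans <| RingEquiv.piCongrRight fun d =>
    (AddMonoidAlgebra.piRingEquiv _ _).trans <| RingEquiv.piCongrRight fun _ =>
    (CirculantRing.equivAddMonoidAlgebra (F d) _).symm.toRingEquiv⟩
end
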